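/- arXiv:1710.05243 — 3 statements merged into one kernel-verified Lean document; each statement's English description precedes it below -/
import Mathlib

section
/- There exists a constant C > 0 such that for all integers n ≥ 1 and all j with 1 ≤ j ≤ n and j < 2·log(n+2): |λ_{n,j} − ((jπ + π/2)/(n+2))^4| ≤ C/(n+2)^4. -/
open Real Set Filter Topology

/-- The symbol `g(x) = (2 sin(x/2))^4`. -/
noncomputable def g (x : ℝ) : ℝ := (2 * Real.sin (x / 2)) ^ 4

/-- The `n × n` pentadiagonal Toeplitz matrix generated by `g`. -/
noncomputable def T (n : ℕ) : Matrix (Fin n) (Fin n) ℝ :=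
  Matrix.of fun j k =>
    if ((j : ℤ) - (k : ℤ)) = 0 then 6
    else if ((j : ℤ) - (k : ℤ)) = 1 ∨ ((j : ℤ) - (k : ℤ)) = -1 then -4
    else if ((j : ℤ) - (k : ℤ)) = 2 ∨ ((j : ℤ) - (k : ℤ)) = -2 then 1
    else 0

/-- Summing over `Fin n` picks out the value at an integer `m`, provided `w` vanishes at `m`
whenever `m` is out of range. -/
lemma sum_fin_ite_int_eq {n : ℕ} (w : ℤ → ℝ) (m : ℤ) (h : (0 ≤ m ∧ m < n) ∨ w m = 0) :
    ∑ k : Fin n, (if (k : ℤ) = m then w k else 0) = w m := by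
  by_cases hm : 0 ≤ m ∧ m < n
  · obtain ⟨a, rfl⟩ := Int.eq_ofNat_of_zero_le hm.1
    have ha : a < n := by exact_mod_cast hm.2
    rw [Finset.sum_eq_single (⟨a, ha⟩ : Fin n)]
    · simp
    · intro b _ hb
      rw [if_neg]
      intro h'
      exact hb (Fin.ext (by exact_mod_cast h'))
    · simp
  · rw [h.resolve_left hm]
    refine Finset.sum_eq_zero fun k _ => ?_
    rw [if_neg]
    rintro rfl
    exact hm ⟨by positivity, by exact_mod_cast k.2⟩

/-- A solution of the fourth-order difference equation with clamped boundary values gives an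
eigenvalue of `T n`. -/
lemma mem_spectrum_T {n : ℕ} {μ : ℝ} (w : ℤ → ℝ) (h₁ : w (-2) = 0) (h₂ : w (-1) = 0)
    (h₃ : w n = 0) (h₄ : w (n + 1) = 0)
    (hrec : ∀ k, w (k - 2) - 4 * w (k - 1) + 6 * w k - 4 * w (k + 1) + w (k + 2) = μ * w k)
    (hne : ∃ k : ℤ, 0 ≤ k ∧ k < n ∧ w k ≠ 0) : μ ∈ spectrum ℝ (T n) := by
  have hmul : (T n).mulVec (fun k : Fin n => w k) = μ • (fun k : Fin n => w k) := by
    ext i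
    have hi : (i : ℤ) < n := by exact_mod_cast i.2
    have hi0 : (0 : ℤ) ≤ i := by positivity
    have hterm : ∀ k : Fin n, T n i k * w k =
        (if (k : ℤ) = i - 2 then w k else 0) - 4 * (if (k : ℤ) = i - 1 then w k else 0)
        + 6 * (if (k : ℤ) = i then w k else 0) - 4 * (if (k : ℤ) = i + 1 then w k else 0)
        + (if (k : ℤ) = i + 2 then w k else 0) := by
      intro k
      simp only [T, Matrix.of_apply]
      generalize w k = x
      split_ifs <;> first | omega | ring
    have e₁ : (0 ≤ (i : ℤ) - 2 ∧ (i : ℤ) - 2 < n) ∨ w (i - 2) = 0 := by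
      rcases (by omega : 0 ≤ (i : ℤ) - 2 ∨ (i : ℤ) - 2 = -1 ∨ (i : ℤ) - 2 = -2) with h | h | h
      · left; omega
      · right; rw [h, h₂]
      · right; rw [h, h₁]
    have e₂ : (0 ≤ (i : ℤ) - 1 ∧ (i : ℤ) - 1 < n) ∨ w (i - 1) = 0 := by
      rcases (by omega : 0 ≤ (i : ℤ) - 1 ∨ (i : ℤ) - 1 = -1) with h | h
      · left; omega
      · right; rw [h, h₂]
    have e₃ : (0 ≤ (i : ℤ) + 1 ∧ (i : ℤ) + 1 < n) ∨ w (i + 1) = 0 := by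
      rcases (by omega : (i : ℤ) + 1 < n ∨ (i : ℤ) + 1 = n) with h | h
      · left; omega
      · right; rw [h, h₃]
    have e₄ : (0 ≤ (i : ℤ) + 2 ∧ (i : ℤ) + 2 < n) ∨ w (i + 2) = 0 := by
      rcases (by omega : (i : ℤ) + 2 < n ∨ (i : ℤ) + 2 = n ∨ (i : ℤ) + 2 = n + 1) with h | h | h
      · left; omega
      · right; rw [h, h₃]
      · right; rw [h, h₄]
    simp only [Matrix.mulVec, dotProduct, hterm, Finset.sum_add_distrib, Finset.sum_sub_distrib,
      ← Finset.mul_sum, Pi.smul_apply, smul_eq_mul]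
    rw [sum_fin_ite_int_eq w _ e₁, sum_fin_ite_int_eq w _ e₂, sum_fin_ite_int_eq w _ e₃,
      sum_fin_ite_int_eq w _ e₄, sum_fin_ite_int_eq w _ (Or.inl ⟨hi0, hi⟩), hrec]
  rw [spectrum.mem_iff, Matrix.isUnit_iff_isUnit_det, isUnit_iff_ne_zero, not_not,
    ← Matrix.exists_mulVec_eq_zero_iff]
  refine ⟨fun k => w k, ?_, ?_⟩
  · obtain ⟨k, hk0, hkn, hk⟩ := hne
    obtain ⟨a, rfl⟩ := Int.eq_ofNat_of_zero_le hk0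
    intro h
    exact hk (by simpa using congrFun h ⟨a, by exact_mod_cast hkn⟩)
  · rw [Matrix.sub_mulVec, hmul, Algebra.algebraMap_eq_smul_one, Matrix.smul_mulVec,
      Matrix.one_mulVec, sub_self]

/-- The eigenvector is a combination of an oscillating and an exponential solution of two
second-order recurrences. -/
lemma sq_mem_spectrum_T {n : ℕ} (hn : 1 ≤ n) {s A B : ℝ} (hs : s ≠ 0) (hA : A ≠ 0)
    (p q : ℤ → ℝ)
    (hp : ∀ k, p (k + 1) + p (k - 1) = (2 - s) * p k)
    (hq : ∀ k, q (k + 1) + q (k - 1) = (2 + s) * q k)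
    (hp0 : ¬ (p (-1) = 0 ∧ p 0 = 0))
    (h₁ : A * p (-2) + B * q (-2) = 0) (h₂ : A * p (-1) + B * q (-1) = 0)
    (h₃ : A * p n + B * q n = 0) (h₄ : A * p (n + 1) + B * q (n + 1) = 0) :
    s ^ 2 ∈ spectrum ℝ (T n) := by
  refine mem_spectrum_T (fun k => A * p k + B * q k) h₁ h₂ h₃ h₄ ?_ ?_
  · intro k
    have a₁ := hp k
    have a₂ := hp (k + 1)
    have a₃ := hp (k - 1)
    have b₁ := hq k
    have b₂ := hq (k + 1)
    have b₃ := hq (k - 1)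
    rw [show k + 1 + 1 = k + 2 by ring, show k + 1 - 1 = k by ring] at a₂ b₂
    rw [show k - 1 + 1 = k by ring, show k - 1 - 1 = k - 2 by ring] at a₃ b₃
    linear_combination A * (a₂ + a₃) + B * (b₂ + b₃) + A * (-s - 2) * a₁ + B * (s - 2) * b₁
  · by_contra! hcon
    have hz : ∀ k : ℤ, -2 ≤ k → k ≤ n + 1 → A * p k + B * q k = 0 := by
      intro k hk hk'
      rcases (by omega : k = -2 ∨ k = -1 ∨ (0 ≤ k ∧ k < n) ∨ k = n ∨ k = n + 1) with
        rfl | rfl | h | rfl | rfl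
      · exact h₁
      · exact h₂
      · exact hcon k h.1 h.2
      · exact h₃
      · exact h₄
    have hpz : ∀ k : ℤ, -1 ≤ k → k ≤ n → p k = 0 := by
      intro k hk hk'
      have c₁ := hz k (by omega) (by omega)
      have c₂ := hz (k + 1) (by omega) (by omega)
      have c₃ := hz (k - 1) (by omega) (by omega)
      have h : (2 * s * A) * p k = 0 := by
        linear_combination (2 + s) * c₁ - c₂ - c₃ + A * hp k + B * hq k
      exact (mul_eq_zero.1 h).resolve_left (by positivity)
    exact hp0 ⟨hpz _ (by omega) (by omega), hpz _ (by omega) (by omega)⟩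

lemma even_mem_spectrum_T {n : ℕ} (hn : 1 ≤ n) {y z : ℝ} (hy0 : 0 < y) (hy : y < π / 2)
    (hz : sinh z = sin y)
    (h : cos ((n + 2) * y) * (cos y * sinh ((n + 2) * z))
      + sin ((n + 2) * y) * (cosh ((n + 2) * z) * cosh z) = 0) :
    (2 * sin y) ^ 4 ∈ spectrum ℝ (T n) := by
  have hsin : 0 < sin y := sin_pos_of_pos_of_lt_pi hy0 (by linarith)
  have hcos : 0 < cos y := cos_pos_of_mem_Ioo ⟨by linarith, hy⟩
  have hcy : cos (2 * y) = 1 - 2 * sin y ^ 2 := by rw [cos_two_mul, cos_sq']; ring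
  have hcz : cosh (2 * z) = 1 + 2 * sin y ^ 2 := by rw [cosh_two_mul, cosh_sq, hz]; ring
  have key : cosh ((n + 1) * z) * cos ((n + 3) * y) = cos ((n + 1) * y) * cosh ((n + 3) * z) := by
    rw [show ((n : ℝ) + 1) * z = (n + 2) * z - z by ring,
      show ((n : ℝ) + 3) * z = (n + 2) * z + z by ring,
      show ((n : ℝ) + 1) * y = (n + 2) * y - y by ring,
      show ((n : ℝ) + 3) * y = (n + 2) * y + y by ring, cosh_sub, cosh_add, cos_sub, cos_add, hz]
    linear_combination (-2 * sin y) * h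
  have := sq_mem_spectrum_T hn (s := (2 * sin y) ^ 2) (A := cosh ((n + 1) * z))
    (B := - cos ((n + 1) * y)) (by positivity) (cosh_pos _).ne'
    (fun k => cos ((2 * k - n + 1) * y)) (fun k => cosh ((2 * k - n + 1) * z)) ?_ ?_ ?_ ?_ ?_ ?_ ?_
  · convert this using 1; ring
  · intro k
    push_cast
    rw [show (2 * ((k : ℝ) + 1) - n + 1) * y = (2 * k - n + 1) * y + 2 * y by ring,
      show (2 * ((k : ℝ) - 1) - n + 1) * y = (2 * k - n + 1) * y - 2 * y by ring,
      cos_add, cos_sub, hcy]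
    ring
  · intro k
    push_cast
    rw [show (2 * ((k : ℝ) + 1) - n + 1) * z = (2 * k - n + 1) * z + 2 * z by ring,
      show (2 * ((k : ℝ) - 1) - n + 1) * z = (2 * k - n + 1) * z - 2 * z by ring,
      cosh_add, cosh_sub, hcz]
    ring
  · rintro ⟨ha, hb⟩
    push_cast at ha hb
    rw [show (2 * (0 : ℝ) - n + 1) * y = (2 * (-1) - n + 1) * y + 2 * y by ring, cos_add, ha,
      sin_two_mul] at hb
    have hs : sin ((2 * (-1) - n + 1) * y) = 0 := by
      have : sin ((2 * (-1) - n + 1) * y) * (2 * sin y * cos y) = 0 := by linarith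
      exact (mul_eq_zero.1 this).resolve_right (by positivity)
    have := sin_sq_add_cos_sq ((2 * (-1) - n + 1) * y)
    rw [ha, hs] at this
    norm_num at this
  · push_cast
    rw [show (2 * (-2 : ℝ) - n + 1) * y = -((n + 3) * y) by ring,
      show (2 * (-2 : ℝ) - n + 1) * z = -((n + 3) * z) by ring, cos_neg, cosh_neg]
    linarith
  · push_cast
    rw [show (2 * (-1 : ℝ) - n + 1) * y = -((n + 1) * y) by ring,
      show (2 * (-1 : ℝ) - n + 1) * z = -((n + 1) * z) by ring, cos_neg, cosh_neg]
    ring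
  · push_cast
    rw [show (2 * (n : ℝ) - n + 1) = n + 1 by ring]
    ring
  · push_cast
    rw [show (2 * ((n : ℝ) + 1) - n + 1) = n + 3 by ring]
    linarith

lemma odd_mem_spectrum_T {n : ℕ} (hn : 1 ≤ n) {y z : ℝ} (hy0 : 0 < y) (hy : y < π / 2)
    (hz : sinh z = sin y)
    (h : sin ((n + 2) * y) * (cos y * cosh ((n + 2) * z))
      = cos ((n + 2) * y) * (sinh ((n + 2) * z) * cosh z)) :
    (2 * sin y) ^ 4 ∈ spectrum ℝ (T n) := by
  have hsin : 0 < sin y := sin_pos_of_pos_of_lt_pi hy0 (by linarith)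
  have hcos : 0 < cos y := cos_pos_of_mem_Ioo ⟨by linarith, hy⟩
  have hz0 : 0 < z := by rw [← sinh_pos_iff, hz]; exact hsin
  have hcy : cos (2 * y) = 1 - 2 * sin y ^ 2 := by rw [cos_two_mul, cos_sq']; ring
  have hcz : cosh (2 * z) = 1 + 2 * sin y ^ 2 := by rw [cosh_two_mul, cosh_sq, hz]; ring
  have key : sinh ((n + 1) * z) * sin ((n + 3) * y) = sin ((n + 1) * y) * sinh ((n + 3) * z) := by
    rw [show ((n : ℝ) + 1) * z = (n + 2) * z - z by ring,
      show ((n : ℝ) + 3) * z = (n + 2) * z + z by ring,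
      show ((n : ℝ) + 1) * y = (n + 2) * y - y by ring,
      show ((n : ℝ) + 3) * y = (n + 2) * y + y by ring, sinh_sub, sinh_add, sin_sub, sin_add, hz]
    linear_combination (-2 * sin y) * h
  have := sq_mem_spectrum_T hn (s := (2 * sin y) ^ 2) (A := sinh ((n + 1) * z))
    (B := - sin ((n + 1) * y)) (by positivity) (sinh_pos_iff.2 (by positivity)).ne'
    (fun k => sin ((2 * k - n + 1) * y)) (fun k => sinh ((2 * k - n + 1) * z)) ?_ ?_ ?_ ?_ ?_ ?_ ?_
  · convert this using 1; ring
  · intro k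
    push_cast
    rw [show (2 * ((k : ℝ) + 1) - n + 1) * y = (2 * k - n + 1) * y + 2 * y by ring,
      show (2 * ((k : ℝ) - 1) - n + 1) * y = (2 * k - n + 1) * y - 2 * y by ring,
      sin_add, sin_sub, hcy]
    ring
  · intro k
    push_cast
    rw [show (2 * ((k : ℝ) + 1) - n + 1) * z = (2 * k - n + 1) * z + 2 * z by ring,
      show (2 * ((k : ℝ) - 1) - n + 1) * z = (2 * k - n + 1) * z - 2 * z by ring,
      sinh_add, sinh_sub, hcz]
    ring
  · rintro ⟨ha, hb⟩
    push_cast at ha hb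
    rw [show (2 * (0 : ℝ) - n + 1) * y = (2 * (-1) - n + 1) * y + 2 * y by ring, sin_add, ha,
      sin_two_mul] at hb
    have hs : cos ((2 * (-1) - n + 1) * y) = 0 := by
      have : cos ((2 * (-1) - n + 1) * y) * (2 * sin y * cos y) = 0 := by linarith
      exact (mul_eq_zero.1 this).resolve_right (by positivity)
    have := sin_sq_add_cos_sq ((2 * (-1) - n + 1) * y)
    rw [ha, hs] at this
    norm_num at this
  · push_cast
    rw [show (2 * (-2 : ℝ) - n + 1) * y = -((n + 3) * y) by ring,
      show (2 * (-2 : ℝ) - n + 1) * z = -((n + 3) * z) by ring, sin_neg, sinh_neg]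
    linarith
  · push_cast
    rw [show (2 * (-1 : ℝ) - n + 1) * y = -((n + 1) * y) by ring,
      show (2 * (-1 : ℝ) - n + 1) * z = -((n + 1) * z) by ring, sin_neg, sinh_neg]
    ring
  · push_cast
    rw [show (2 * (n : ℝ) - n + 1) = n + 1 by ring]
    ring
  · push_cast
    rw [show (2 * ((n : ℝ) + 1) - n + 1) = n + 3 by ring]
    linarith

/-- Lower bound for `arsinh` on the unit interval. -/
lemma half_le_arsinh {x : ℝ} (hx0 : 0 ≤ x) (hx1 : x ≤ 1) : x / 2 ≤ arsinh x := by
  have h1 : 1 ≤ √(1 + x ^ 2) := Real.one_le_sqrt.2 (by nlinarith)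
  have h2 : 1 - (1 + x)⁻¹ ≤ log (1 + x) := one_sub_inv_le_log_of_pos (by linarith)
  have h3 : log (1 + x) ≤ arsinh x := log_le_log (by linarith) (by linarith)
  have h4 : x / 2 ≤ 1 - (1 + x)⁻¹ := by
    rw [show 1 - (1 + x)⁻¹ = x / (1 + x) by field_simp; ring]
    gcongr
    linarith
  linarith

/-- If `tan β` is close to `1`, as measured by `|sin β - cos β|`, then `β` is close to `π / 4`. -/
lemma abs_sub_pi_div_four_le {β D : ℝ} (h0 : 0 ≤ β) (h1 : β ≤ π / 2)
    (h : |sin β - cos β| ≤ D) : |β - π / 4| ≤ 2 * D := by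
  have hpi := pi_pos
  have h2 := mul_abs_le_abs_sin (x := β - π / 4) (abs_le.2 ⟨by linarith, by linarith⟩)
  have h3 : |sin (β - π / 4)| ≤ |sin β - cos β| := by
    rw [sin_sub, cos_pi_div_four, sin_pi_div_four, ← sub_mul, abs_mul]
    refine mul_le_of_le_one_right (abs_nonneg _) ?_
    rw [abs_of_nonneg (by positivity)]
    nlinarith [Real.sq_sqrt (show (0 : ℝ) ≤ 2 by norm_num), Real.sqrt_nonneg 2]
  have h4 : 1 / 2 * |β - π / 4| ≤ 2 / π * |β - π / 4| := by
    gcongr ?_ * _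
    rw [div_le_div_iff₀ (by norm_num) hpi]
    linarith [pi_le_four]
  linarith

lemma abs_le_add_of_mul_eq_add {x W u v a b : ℝ} (hW : 0 < W) (h : x * W = u + v)
    (hu : |u| ≤ a * W) (hv : |v| ≤ b * W) : |x| ≤ a + b := by
  refine le_of_mul_le_mul_right ?_ hW
  calc |x| * W = |u + v| := by rw [← h, abs_mul, abs_of_pos hW]
    _ ≤ |u| + |v| := abs_add_le _ _
    _ ≤ (a + b) * W := by linarith

/-- Each interval `(j π / 2, (j + 1) π / 2)` contains a rescaled node, close to its midpoint. -/
lemma exists_node {n : ℕ} (hn : 1 ≤ n) {j : ℕ} (hj : 1 ≤ j) (hjn : j ≤ n) :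
    ∃ y : ℝ, j * (π / 2) ≤ (n + 2) * y ∧ (n + 2) * y < (j + 1) * (π / 2) ∧
      (2 * sin y) ^ 4 ∈ spectrum ℝ (T n) ∧
      |(n + 2) * y - (j * (π / 2) + π / 4)| ≤ 2 * (2 * sin y ^ 2 + exp (-(j / 2))) := by
  have hpi := pi_pos
  have hN : (0 : ℝ) < n + 2 := by positivity
  have hj' : (1 : ℝ) ≤ j := by exact_mod_cast hj
  have hjn' : (j : ℝ) ≤ n := by exact_mod_cast hjn
  let Y : ℝ → ℝ := fun β => (j * (π / 2) + β) / (n + 2)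
  let Z : ℝ → ℝ := fun β => arsinh (sin (Y β))
  have hYc : Continuous Y := by fun_prop
  have hZc : Continuous Z := (continuous_sin.comp hYc).arsinh
  have hNY : ∀ β, (n + 2) * Y β = j * (π / 2) + β := fun β => mul_div_cancel₀ _ hN.ne'
  have hY0 : ∀ β, 0 ≤ β → 0 < Y β := fun β hβ => by positivity
  have hY1 : ∀ β, β ≤ π / 2 → Y β < π / 2 := fun β hβ => by
    rw [div_lt_iff₀ hN]; nlinarith
  have hsY : ∀ β, 0 ≤ β → β ≤ π / 2 → 0 < sin (Y β) := fun β h h' =>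
    sin_pos_of_pos_of_lt_pi (hY0 β h) (by linarith [hY1 β h'])
  have hcY : ∀ β, 0 ≤ β → β ≤ π / 2 → 0 < cos (Y β) := fun β h h' =>
    cos_pos_of_mem_Ioo ⟨by linarith [hY0 β h], hY1 β h'⟩
  have hZ0 : ∀ β, 0 ≤ β → β ≤ π / 2 → 0 < Z β := fun β h h' => arsinh_pos_iff.2 (hsY β h h')
  have hsZ : ∀ β, sinh (Z β) = sin (Y β) := fun β => sinh_arsinh _
  have hbd : ∀ β, 0 ≤ β → β ≤ π / 2 → 0 ≤ sin β ∧ 0 ≤ cos β ∧ 0 ≤ cosh (Z β) - cos (Y β) ∧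
      cosh (Z β) - cos (Y β) ≤ 2 * sin (Y β) ^ 2 := fun β h h' => by
    have a1 := cosh_sq (Z β)
    rw [hsZ] at a1
    have a2 := sin_sq_add_cos_sq (Y β)
    have a3 := one_le_cosh (Z β)
    have a4 := cos_le_one (Y β)
    have a5 := hcY β h h'
    exact ⟨sin_nonneg_of_nonneg_of_le_pi h (by linarith), cos_nonneg_of_mem_Icc ⟨by linarith, h'⟩,
      by linarith, by nlinarith⟩
  have hexp : ∀ β, 0 ≤ β → β ≤ π / 2 → exp (-((n + 2) * Z β)) ≤ exp (-(j / 2)) := fun β h h' => by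
    have a1 := half_le_arsinh (hsY β h h').le (sin_le_one _)
    have a2 := mul_le_sin (hY0 β h).le (hY1 β h').le
    refine exp_le_exp.2 (neg_le_neg ?_)
    have a3 : 1 / π * Y β ≤ Z β := by
      have : 1 / π * Y β = (2 / π * Y β) / 2 := by ring
      linarith
    calc (j : ℝ) / 2 = 1 / π * (j * (π / 2) + 0) := by field_simp; ring
      _ ≤ 1 / π * (j * (π / 2) + β) := by gcongr
      _ = (n + 2) * (1 / π * Y β) := by rw [← hNY]; ring
      _ ≤ (n + 2) * Z β := by gcongr
  have hsc : ∀ β, cosh ((n + 2) * Z β) - sinh ((n + 2) * Z β) = exp (-((n + 2) * Z β)) :=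
    fun β => cosh_sub_sinh _
  have hroot : ∀ f : ℝ → ℝ, Continuous f → f 0 ≤ 0 → 0 < f (π / 2) →
      ∃ β, 0 ≤ β ∧ β < π / 2 ∧ f β = 0 := fun f hf hf0 hf1 => by
    obtain ⟨β, ⟨hβ0, hβ1⟩, hβ⟩ := intermediate_value_Icc (by positivity : (0 : ℝ) ≤ π / 2)
      hf.continuousOn ⟨hf0, hf1.le⟩
    exact ⟨β, hβ0, lt_of_le_of_ne hβ1 (by rintro rfl; exact hf1.ne' hβ), hβ⟩
  have hmain : ∃ β, 0 ≤ β ∧ β < π / 2 ∧ (2 * sin (Y β)) ^ 4 ∈ spectrum ℝ (T n) ∧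
      |sin β - cos β| ≤ 2 * sin (Y β) ^ 2 + exp (-((n + 2) * Z β)) := by
    rcases Nat.even_or_odd' j with ⟨m, hm | hm⟩
    · let f : ℝ → ℝ := fun β => sin β * (cos (Y β) * cosh ((n + 2) * Z β))
          - cos β * (sinh ((n + 2) * Z β) * cosh (Z β))
      have hf : Continuous f := by fun_prop
      have hf0 : f 0 ≤ 0 := by
        have a1 : 0 < sinh ((n + 2) * Z 0) :=
          sinh_pos_iff.2 (mul_pos hN (hZ0 0 le_rfl (by positivity)))
        have a2 := cosh_pos (Z 0)
        simp only [f, sin_zero, cos_zero]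
        nlinarith
      have hf1 : 0 < f (π / 2) := by
        have a1 := hcY (π / 2) (by positivity) le_rfl
        have a2 := cosh_pos ((n + 2) * Z (π / 2))
        simp only [f, sin_pi_div_two, cos_pi_div_two]
        nlinarith [mul_pos a1 a2]
      obtain ⟨β, hβ0, hβ2, hβ⟩ := hroot f hf hf0 hf1
      have hβ' : sin β * (cos (Y β) * cosh ((n + 2) * Z β))
          - cos β * (sinh ((n + 2) * Z β) * cosh (Z β)) = 0 := hβ
      obtain ⟨hs, hco, d0, d1⟩ := hbd β hβ0 hβ2.le
      refine ⟨β, hβ0, hβ2, odd_mem_spectrum_T hn (hY0 β hβ0) (hY1 β hβ2.le) (hsZ β) ?_, ?_⟩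
      · rw [hNY, hm, show ((2 * m : ℕ) : ℝ) * (π / 2) + β = β + m * π by push_cast; ring,
          sin_add_nat_mul_pi, cos_add_nat_mul_pi]
        linear_combination (-1) ^ m * hβ'
      · refine abs_le_add_of_mul_eq_add (W := cosh ((n + 2) * Z β) * cosh (Z β))
          (u := sin β * (cosh ((n + 2) * Z β) * (cosh (Z β) - cos (Y β))))
          (v := -(cos β * (cosh (Z β) * exp (-((n + 2) * Z β))))) (by positivity) ?_ ?_ ?_
        · rw [← hsc]; linear_combination hβ'
        · rw [abs_of_nonneg (by positivity)]
          calc _ ≤ 1 * (cosh ((n + 2) * Z β) * (2 * sin (Y β) ^ 2)) := by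
                gcongr; exact sin_le_one β
            _ = 2 * sin (Y β) ^ 2 * (cosh ((n + 2) * Z β) * 1) := by ring
            _ ≤ _ := by gcongr; exact one_le_cosh _
        · rw [abs_neg, abs_of_nonneg (by positivity)]
          calc _ ≤ 1 * (cosh (Z β) * exp (-((n + 2) * Z β))) := by
                gcongr; exact cos_le_one β
            _ = exp (-((n + 2) * Z β)) * (1 * cosh (Z β)) := by ring
            _ ≤ _ := by gcongr; exact one_le_cosh _
    · let f : ℝ → ℝ := fun β => sin β * (cos (Y β) * sinh ((n + 2) * Z β))
          - cos β * (cosh ((n + 2) * Z β) * cosh (Z β))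
      have hf : Continuous f := by fun_prop
      have hf0 : f 0 ≤ 0 := by
        have a1 := cosh_pos ((n + 2) * Z 0)
        have a2 := cosh_pos (Z 0)
        simp only [f, sin_zero, cos_zero]
        nlinarith
      have hf1 : 0 < f (π / 2) := by
        have a1 := hcY (π / 2) (by positivity) le_rfl
        have a2 : 0 < sinh ((n + 2) * Z (π / 2)) :=
          sinh_pos_iff.2 (mul_pos hN (hZ0 _ (by positivity) le_rfl))
        simp only [f, sin_pi_div_two, cos_pi_div_two]
        nlinarith [mul_pos a1 a2]
      obtain ⟨β, hβ0, hβ2, hβ⟩ := hroot f hf hf0 hf1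
      have hβ' : sin β * (cos (Y β) * sinh ((n + 2) * Z β))
          - cos β * (cosh ((n + 2) * Z β) * cosh (Z β)) = 0 := hβ
      obtain ⟨hs, hco, d0, d1⟩ := hbd β hβ0 hβ2.le
      have hcY' := hcY β hβ0 hβ2.le
      refine ⟨β, hβ0, hβ2, even_mem_spectrum_T hn (hY0 β hβ0) (hY1 β hβ2.le) (hsZ β) ?_, ?_⟩
      · rw [hNY, hm, show ((2 * m + 1 : ℕ) : ℝ) * (π / 2) + β = β + π / 2 + m * π by
          push_cast; ring, sin_add_nat_mul_pi, cos_add_nat_mul_pi, sin_add_pi_div_two,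
          cos_add_pi_div_two]
        linear_combination -(-1) ^ m * hβ'
      · refine abs_le_add_of_mul_eq_add (W := cosh ((n + 2) * Z β) * cosh (Z β))
          (u := sin β * (cosh ((n + 2) * Z β) * (cosh (Z β) - cos (Y β))))
          (v := sin β * (cos (Y β) * exp (-((n + 2) * Z β)))) (by positivity) ?_ ?_ ?_
        · rw [← hsc]; linear_combination hβ'
        · rw [abs_of_nonneg (by positivity)]
          calc _ ≤ 1 * (cosh ((n + 2) * Z β) * (2 * sin (Y β) ^ 2)) := by
                gcongr; exact sin_le_one β
            _ = 2 * sin (Y β) ^ 2 * (cosh ((n + 2) * Z β) * 1) := by ring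
            _ ≤ _ := by gcongr; exact one_le_cosh _
        · rw [abs_of_nonneg (by positivity)]
          calc _ ≤ 1 * (1 * exp (-((n + 2) * Z β))) := by
                gcongr
                · exact sin_le_one β
                · exact cos_le_one _
            _ = exp (-((n + 2) * Z β)) * (1 * 1) := by ring
            _ ≤ _ := by gcongr <;> exact one_le_cosh _
  obtain ⟨β, hβ0, hβ1, hmem, hb⟩ := hmain
  refine ⟨Y β, by rw [hNY]; linarith, by rw [hNY]; linarith, hmem, ?_⟩
  rw [hNY, show (j : ℝ) * (π / 2) + β - (j * (π / 2) + π / 4) = β - π / 4 by ring]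
  exact abs_sub_pi_div_four_le hβ0 hβ1.le (hb.trans (by linarith [hexp β hβ0 hβ1.le]))

/-- Two strictly increasing enumerations of `n` elements of the spectrum of an `n × n` matrix
coincide. -/
lemma eq_of_strictMono_mem_spectrum {n : ℕ} (M : Matrix (Fin n) (Fin n) ℝ) {f f' : Fin n → ℝ}
    (hf : StrictMono f) (hf' : StrictMono f') (h : ∀ i, f i ∈ spectrum ℝ M)
    (h' : ∀ i, f' i ∈ spectrum ℝ M) : f = f' := by
  have hmem : ∀ r, r ∈ M.charpoly.roots.toFinset ↔ r ∈ spectrum ℝ M := fun r => by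
    rw [Multiset.mem_toFinset, Polynomial.mem_roots M.charpoly_monic.ne_zero,
      Matrix.mem_spectrum_iff_isRoot_charpoly]
  have hcard : M.charpoly.roots.toFinset.card = n := by
    apply le_antisymm
    · refine (Multiset.toFinset_card_le _).trans ((Polynomial.card_roots' _).trans ?_)
      simp
    · have := Finset.card_le_card_of_injOn (s := Finset.univ) f
        (fun i _ => (hmem _).2 (h i)) hf.injective.injOn
      simpa using this
  rw [Finset.orderEmbOfFin_unique hcard (fun i => (hmem _).2 (h i)) hf,
    Finset.orderEmbOfFin_unique hcard (fun i => (hmem _).2 (h' i)) hf']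

lemma pow_four_sub_le {X Y R : ℝ} (hX0 : 0 ≤ X) (hY0 : 0 ≤ Y) (hX : X ≤ R) (hY : Y ≤ R) :
    |X ^ 4 - Y ^ 4| ≤ |X - Y| * (4 * R ^ 3) := by
  rw [show X ^ 4 - Y ^ 4 = (X - Y) * (X ^ 3 + X ^ 2 * Y + X * Y ^ 2 + Y ^ 3) by ring, abs_mul,
    abs_of_nonneg (show 0 ≤ X ^ 3 + X ^ 2 * Y + X * Y ^ 2 + Y ^ 3 by positivity)]
  gcongr
  have hR := hX0.trans hX
  calc X ^ 3 + X ^ 2 * Y + X * Y ^ 2 + Y ^ 3 ≤ R ^ 3 + R ^ 2 * R + R * R ^ 2 + R ^ 3 := by gcongr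
    _ = 4 * R ^ 3 := by ring

lemma abs_two_sin_pow_four_sub_le {y : ℝ} (hy0 : 0 < y) (hy : y < π / 2) :
    |(2 * sin y) ^ 4 - (2 * y) ^ 4| ≤ 32 * y ^ 6 := by
  have h1 := sin_le hy0.le
  have h0 : 0 < sin y := sin_pos_of_pos_of_lt_pi hy0 (by linarith [pi_pos])
  have hc : 0 < cos y := cos_pos_of_mem_Ioo ⟨by linarith, hy⟩
  have h2 : y * cos y ≤ sin y := by
    have := lt_tan hy0 hy
    rw [tan_eq_sin_div_cos, lt_div_iff₀ hc] at this
    exact this.le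
  have h3 : sin y ^ 2 ≤ y ^ 2 := by gcongr
  have h4 : y ^ 2 - y ^ 4 ≤ sin y ^ 2 := by
    have : (y * cos y) ^ 2 ≤ sin y ^ 2 := by gcongr
    rw [mul_pow, cos_sq'] at this
    nlinarith [sq_nonneg y]
  rw [abs_sub_comm, abs_of_nonneg (by nlinarith [sq_nonneg y, sq_nonneg (sin y)])]
  calc (2 * y) ^ 4 - (2 * sin y) ^ 4 = 16 * ((y ^ 2 - sin y ^ 2) * (y ^ 2 + sin y ^ 2)) := by ring
    _ ≤ 16 * (y ^ 4 * (y ^ 2 + y ^ 2)) := by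
        gcongr
        · linarith
    _ = 32 * y ^ 6 := by ring

lemma node_estimate {N J y : ℝ} (hN : 2 ≤ N) (hJ : 1 ≤ J) (hJN : J < 2 * log N)
    (hy0 : 0 < y) (hy : y < π / 2) (hy1 : N * y ≤ (J + 1) * (π / 2))
    (h : |N * y - (J * (π / 2) + π / 4)| ≤ 2 * (2 * sin y ^ 2 + exp (-(J / 2)))) :
    |(2 * sin y) ^ 4 - ((J * π + π / 2) / N) ^ 4| ≤
      (32 * π ^ 6 * 720 + (8 * π ^ 2 * 720 + 4 * 48) * (32 * π ^ 3)) / N ^ 4 := by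
  have hpi := pi_pos
  have hN0 : 0 < N := by linarith
  have hJ0 : 0 < J := by linarith
  have hJ6 : J ^ 6 ≤ 720 * N ^ 2 := by
    have h1 := pow_div_factorial_le_exp (x := J) hJ0.le 6
    have h2 : exp J ≤ N ^ 2 := by
      rw [← exp_log (show 0 < N ^ 2 by positivity), log_pow]
      exact exp_le_exp.2 (by push_cast; exact hJN.le)
    have h3 : ((Nat.factorial 6 : ℕ) : ℝ) = 720 := by norm_num [Nat.factorial]
    rw [h3, div_le_iff₀ (by norm_num)] at h1
    linarith
  have hJe : J ^ 3 * exp (-(J / 2)) ≤ 48 := by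
    have h1 := pow_div_factorial_le_exp (x := J / 2) (by positivity) 3
    have h3 : ((Nat.factorial 3 : ℕ) : ℝ) = 6 := by norm_num [Nat.factorial]
    rw [h3] at h1
    rw [exp_neg, ← div_eq_mul_inv, div_le_iff₀ (exp_pos _)]
    nlinarith
  have hX : 2 * (N * y) ≤ 2 * π * J := by nlinarith
  have hY : J * π + π / 2 ≤ 2 * π * J := by nlinarith
  have hs : sin y ^ 2 ≤ y ^ 2 := by
    have h1 := sin_le hy0.le
    have h0 : 0 < sin y := sin_pos_of_pos_of_lt_pi hy0 (by linarith)
    gcongr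
  have hXN : (N * y) ^ 2 ≤ (π * J) ^ 2 :=
    pow_le_pow_left₀ (by positivity) (by linarith) 2
  have hXN6 : (N * y) ^ 6 ≤ (π * J) ^ 6 :=
    pow_le_pow_left₀ (by positivity) (by linarith) 6
  have e1 : N ^ 4 * |(2 * sin y) ^ 4 - (2 * y) ^ 4| ≤ 32 * π ^ 6 * 720 := by
    calc N ^ 4 * |(2 * sin y) ^ 4 - (2 * y) ^ 4| ≤ N ^ 4 * (32 * y ^ 6) := by
          gcongr; exact abs_two_sin_pow_four_sub_le hy0 hy
      _ = 32 * (N * y) ^ 6 / N ^ 2 := by field_simp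
      _ ≤ 32 * (π * J) ^ 6 / N ^ 2 := by gcongr
      _ = 32 * π ^ 6 * J ^ 6 / N ^ 2 := by ring
      _ ≤ 32 * π ^ 6 * (720 * N ^ 2) / N ^ 2 := by gcongr
      _ = 32 * π ^ 6 * 720 := by field_simp
  have hd : |2 * (N * y) - (J * π + π / 2)| ≤ 8 * (π * J) ^ 2 / N ^ 2 + 4 * exp (-(J / 2)) := by
    have h1 : 2 * (N * y) - (J * π + π / 2) = 2 * (N * y - (J * (π / 2) + π / 4)) := by ring
    have h2 : y ^ 2 ≤ (π * J) ^ 2 / N ^ 2 := by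
      rw [le_div_iff₀ (by positivity)]; linarith [mul_pow N y 2]
    rw [h1, abs_mul, abs_two, mul_div_assoc]
    linarith
  have e2 : |(2 * (N * y)) ^ 4 - (J * π + π / 2) ^ 4| ≤
      (8 * π ^ 2 * 720 + 4 * 48) * (32 * π ^ 3) := by
    calc _ ≤ |2 * (N * y) - (J * π + π / 2)| * (4 * (2 * π * J) ^ 3) :=
          pow_four_sub_le (by positivity) (by positivity) hX hY
      _ ≤ (8 * (π * J) ^ 2 / N ^ 2 + 4 * exp (-(J / 2))) * (4 * (2 * π * J) ^ 3) := by gcongr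
      _ = (8 * π ^ 2 * (J ^ 5 / N ^ 2) + 4 * (J ^ 3 * exp (-(J / 2)))) * (32 * π ^ 3) := by ring
      _ ≤ (8 * π ^ 2 * 720 + 4 * 48) * (32 * π ^ 3) := by
          gcongr
          rw [div_le_iff₀ (by positivity)]
          exact (pow_le_pow_right₀ hJ (by norm_num)).trans hJ6
  rw [le_div_iff₀ (by positivity)]
  have hN4 : |N ^ 4| = N ^ 4 := abs_of_pos (by positivity)
  calc |(2 * sin y) ^ 4 - ((J * π + π / 2) / N) ^ 4| * N ^ 4
      = |N ^ 4 * ((2 * sin y) ^ 4 - (2 * y) ^ 4) +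
          ((2 * (N * y)) ^ 4 - (J * π + π / 2) ^ 4)| := by
        rw [← hN4, ← abs_mul, hN4]
        congr 1
        field_simp
        ring
    _ ≤ N ^ 4 * |(2 * sin y) ^ 4 - (2 * y) ^ 4| +
          |(2 * (N * y)) ^ 4 - (J * π + π / 2) ^ 4| := by
        refine (abs_add_le _ _).trans_eq ?_
        rw [abs_mul, hN4]
    _ ≤ _ := add_le_add e1 e2

theorem stmt15 (lam : ℕ → ℕ → ℝ)
    (hmono : ∀ n, 1 ≤ n → ∀ j k, 1 ≤ j → j < k → k ≤ n → lam n j < lam n k)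
    (hspec : ∀ n, 1 ≤ n → ∀ j, 1 ≤ j → j ≤ n → lam n j ∈ spectrum ℝ (T n)) :
    ∃ C : ℝ, 0 < C ∧ ∀ n : ℕ, 1 ≤ n → ∀ j : ℕ, 1 ≤ j → j ≤ n →
      (j : ℝ) < 2 * Real.log ((n : ℝ) + 2) →
      |lam n j - (((j : ℝ) * Real.pi + Real.pi / 2) / ((n : ℝ) + 2)) ^ 4|
        ≤ C / ((n : ℝ) + 2) ^ 4 := by
  refine ⟨32 * π ^ 6 * 720 + (8 * π ^ 2 * 720 + 4 * 48) * (32 * π ^ 3), by positivity, ?_⟩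
  intro n hn j hj hjn hlog
  have hpi := pi_pos
  have hN : (0 : ℝ) < n + 2 := by positivity
  choose y hy1 hy2 hy3 hy4 using
    fun i : Fin n => exists_node hn (j := i + 1) (by omega) (by omega)
  have hy0 : ∀ i, 0 < y i := fun i => by
    have : 0 < (n + 2) * y i := lt_of_lt_of_le (by positivity) (hy1 i)
    exact (pos_iff_pos_of_mul_pos this).1 hN
  have hyp : ∀ i, y i < π / 2 := fun i => by
    have h1 := hy2 i
    have h2 : (((i : ℕ) + 1 : ℕ) : ℝ) ≤ n := by exact_mod_cast i.2
    nlinarith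
  have hymono : StrictMono y := fun a b hab => by
    have h1 : (((a : ℕ) + 1 : ℕ) : ℝ) + 1 ≤ ((b : ℕ) + 1 : ℕ) := by
      have : (a : ℕ) < b := hab
      exact_mod_cast (by omega : (a : ℕ) + 1 + 1 ≤ b + 1)
    have h2 : ((n : ℝ) + 2) * y a < (n + 2) * y b :=
      (hy2 a).trans_le (le_trans (by gcongr) (hy1 b))
    exact lt_of_mul_lt_mul_left h2 hN.le
  have hfun : (fun i : Fin n => lam n (i + 1)) = fun i => (2 * sin (y i)) ^ 4 := by
    refine eq_of_strictMono_mem_spectrum (T n) ?_ ?_ (fun i => hspec n hn _ (by omega) (by omega))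
      hy3
    · intro a b hab
      have : (a : ℕ) < b := hab
      exact hmono n hn _ _ (by omega) (by omega) (by omega)
    · intro a b hab
      have h1 := sin_lt_sin_of_lt_of_le_pi_div_two (by linarith [hy0 a]) (hyp b).le (hymono hab)
      have h2 : 0 < sin (y a) := sin_pos_of_pos_of_lt_pi (hy0 a) (by linarith [hyp a])
      show (2 * sin (y a)) ^ 4 < (2 * sin (y b)) ^ 4
      gcongr
  obtain ⟨i, rfl⟩ : ∃ i : ℕ, j = i + 1 := ⟨j - 1, by omega⟩
  let i' : Fin n := ⟨i, by omega⟩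
  have hlam : lam n (i + 1) = (2 * sin (y i')) ^ 4 := congrFun hfun i'
  rw [hlam]
  exact node_estimate (by linarith [(Nat.cast_nonneg n : (0 : ℝ) ≤ n)]) (by exact_mod_cast hj)
    hlog (hy0 i') (hyp i') (hy2 i').le (hy4 i')
end

section
/- The matrices T_n(g) are invertible for all n ≥ 1, and lim_{n→∞} (α_1/(n+2))^4 · ‖T_n(g)^{−1}‖_2 = 1 and lim_{n→∞} (α_1/(n+2))^4 · cond_2(T_n(g)) = 16, where ‖·‖_2 is the spectral (operator 2-) norm and cond_2(T_n(g)) = ‖T_n(g)‖_2 · ‖T_n(g)^{−1}‖_2. Equivalently, lim_{n→∞} (n+2)^4 λ_{n,1} = α_1^4 and lim_{n→∞} λ_{n,n} = 16. -/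
open Real Set Filter Topology

/-- The spectral (operator 2-) norm of a real square matrix. -/
noncomputable def opNorm2 {n : ℕ} (A : Matrix (Fin n) (Fin n) ℝ) : ℝ :=
  ‖Matrix.toEuclideanCLM (𝕜 := ℝ) A‖

/-- The second difference of a sequence. -/
def secondDiff (y : ℕ → ℝ) (k : ℕ) : ℝ := y k - 2 * y (k + 1) + y (k + 2)

/-- The fourth difference of a sequence. -/
def fourthDiff (y : ℕ → ℝ) (k : ℕ) : ℝ :=
  y k - 4 * y (k + 1) + 6 * y (k + 2) - 4 * y (k + 3) + y (k + 4)

theorem sum_mul_fourthDiff (w y : ℕ → ℝ) (n : ℕ) :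
    ∑ k ∈ Finset.range n, w (k + 2) * fourthDiff y k =
      ∑ k ∈ Finset.range n, secondDiff w k * secondDiff y k
      + (w n * secondDiff y n + w (n + 1) * secondDiff y (n + 1)
          - 2 * w (n + 1) * secondDiff y n)
      - (w 0 * secondDiff y 0 + w 1 * secondDiff y 1 - 2 * w 1 * secondDiff y 0) := by
  induction n with
  | zero => simp
  | succ n ih =>
    rw [Finset.sum_range_succ, Finset.sum_range_succ, ih]
    simp only [fourthDiff, secondDiff, add_assoc, Nat.reduceAdd]
    ring

/-- Summation by parts for sequences vanishing at both ends. -/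
theorem sum_mul_fourthDiff_self {y : ℕ → ℝ} {n : ℕ} (h0 : y 0 = 0) (h1 : y 1 = 0)
    (h2 : y (n + 2) = 0) (h3 : y (n + 3) = 0) :
    ∑ k ∈ Finset.range n, y (k + 2) * fourthDiff y k =
      ∑ k ∈ Finset.range (n + 2), secondDiff y k ^ 2 := by
  rw [sum_mul_fourthDiff, Finset.sum_range_succ, Finset.sum_range_succ]
  simp only [← sq, h0, h1]
  simp only [secondDiff, add_assoc, Nat.reduceAdd, h2, h3]
  ring

/-- Green identity for two solutions of the eigenvalue recurrence, one of which vanishes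
at both ends. -/
theorem boundary_identity {w y : ℕ → ℝ} {n : ℕ} {μ : ℝ} (h0 : y 0 = 0) (h1 : y 1 = 0)
    (h2 : y (n + 2) = 0) (h3 : y (n + 3) = 0)
    (hy : ∀ k < n, fourthDiff y k = μ * y (k + 2))
    (hw : ∀ k, fourthDiff w k = μ * w (k + 2)) :
    w 0 * y 2 + w 1 * (y 3 - 4 * y 2) + w (n + 2) * (y n - 4 * y (n + 1))
      + w (n + 3) * y (n + 1) = 0 := by
  have e : ∑ k ∈ Finset.range n, w (k + 2) * fourthDiff y k =
      ∑ k ∈ Finset.range n, y (k + 2) * fourthDiff w k := by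
    refine Finset.sum_congr rfl fun k hk => ?_
    rw [hy k (Finset.mem_range.1 hk), hw]
    ring
  rw [sum_mul_fourthDiff, sum_mul_fourthDiff] at e
  have e' : ∑ k ∈ Finset.range n, secondDiff w k * secondDiff y k =
      ∑ k ∈ Finset.range n, secondDiff y k * secondDiff w k :=
    Finset.sum_congr rfl fun k _ => mul_comm _ _
  rw [e'] at e
  simp only [secondDiff, add_assoc, Nat.reduceAdd, h0, h1, h2, h3] at e
  linarith

theorem T_mulVec {y : ℕ → ℝ} {n : ℕ} (h0 : y 0 = 0) (h1 : y 1 = 0)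
    (h2 : y (n + 2) = 0) (h3 : y (n + 3) = 0) (i : Fin n) :
    (T n).mulVec (fun j : Fin n => y (j + 2)) i = fourthDiff y i := by
  have hi := i.2
  let c : ℕ → ℝ := fun k => (if k = i then 1 else 0) + (if k = i + 1 then -4 else 0)
    + (if k = i + 2 then 6 else 0) + (if k = i + 3 then -4 else 0) + (if k = i + 4 then 1 else 0)
  have e : (T n).mulVec (fun j : Fin n => y (j + 2)) i =
      ∑ k ∈ Finset.range n, c (k + 2) * y (k + 2) := by
    rw [Matrix.mulVec, dotProduct, ← Fin.sum_univ_eq_sum_range (fun k => c (k + 2) * y (k + 2))]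
    refine Finset.sum_congr rfl fun j _ => ?_
    congr 1
    simp only [T, Matrix.of_apply, c]
    split_ifs <;> first | omega | norm_num
  have e2 : ∑ k ∈ Finset.range n, c (k + 2) * y (k + 2) =
      ∑ k ∈ Finset.range (n + 4), c k * y k := by
    rw [Finset.sum_range_succ, Finset.sum_range_succ, Finset.sum_range_succ',
      Finset.sum_range_succ']
    simp [h0, h1, h2, h3]
  rw [e, e2]
  simp only [c, add_mul, Finset.sum_add_distrib, ite_mul, zero_mul, Finset.sum_ite_eq',
    Finset.mem_range]
  rw [if_pos (by omega), if_pos (by omega), if_pos (by omega), if_pos (by omega),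
    if_pos (by omega), fourthDiff]
  ring

/-- Every vector is the restriction of a sequence vanishing at both ends. -/
theorem exists_extension {n : ℕ} (x : Fin n → ℝ) :
    ∃ y : ℕ → ℝ, y 0 = 0 ∧ y 1 = 0 ∧ y (n + 2) = 0 ∧ y (n + 3) = 0 ∧
      x = fun j : Fin n => y (j + 2) := by
  refine ⟨fun k => if h : 2 ≤ k ∧ k - 2 < n then x ⟨k - 2, h.2⟩ else 0, ?_, ?_, ?_, ?_, ?_⟩
  · simp
  · simp
  · simp
  · exact dif_neg (by omega)
  · funext j
    simp

theorem T_isHermitian (n : ℕ) : (T n).IsHermitian := by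
  ext i j
  simp only [Matrix.conjTranspose_apply, T, Matrix.of_apply, star_trivial]
  split_ifs <;> first | omega | rfl

theorem mem_spectrum_iff_exists {n : ℕ} (A : Matrix (Fin n) (Fin n) ℝ) (μ : ℝ) :
    μ ∈ spectrum ℝ A ↔ ∃ x : Fin n → ℝ, x ≠ 0 ∧ A.mulVec x = μ • x := by
  rw [← Matrix.spectrum_toLin', ← Module.End.hasEigenvalue_iff_mem_spectrum]
  constructor
  · intro h
    obtain ⟨x, hx⟩ := h.exists_hasEigenvector
    exact ⟨x, hx.2, by simpa using hx.apply_eq_smul⟩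
  · rintro ⟨x, hx, h⟩
    exact Module.End.hasEigenvalue_of_hasEigenvector (x := x)
      ⟨Module.End.mem_eigenspace_iff.2 (by simpa using h), hx⟩

theorem mem_spectrum_T_iff {n : ℕ} (μ : ℝ) :
    μ ∈ spectrum ℝ (T n) ↔ ∃ y : ℕ → ℝ, y 0 = 0 ∧ y 1 = 0 ∧ y (n + 2) = 0 ∧ y (n + 3) = 0 ∧
      (∃ k < n, y (k + 2) ≠ 0) ∧ ∀ k < n, fourthDiff y k = μ * y (k + 2) := by
  rw [mem_spectrum_iff_exists]
  constructor
  · rintro ⟨x, hx, h⟩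
    obtain ⟨y, h0, h1, h2, h3, rfl⟩ := exists_extension x
    refine ⟨y, h0, h1, h2, h3, ?_, fun k hk => ?_⟩
    · obtain ⟨i, hi⟩ := Function.ne_iff.1 hx
      exact ⟨i, i.2, hi⟩
    · rw [← T_mulVec h0 h1 h2 h3 ⟨k, hk⟩, h]
      rfl
  · rintro ⟨y, h0, h1, h2, h3, ⟨k, hk, hne⟩, h⟩
    refine ⟨fun j : Fin n => y (j + 2), fun h => hne (congrFun h ⟨k, hk⟩), ?_⟩
    funext i
    rw [T_mulVec h0 h1 h2 h3, h i i.2]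
    rfl

theorem secondDiff_ne_zero {y : ℕ → ℝ} {n : ℕ} (h0 : y 0 = 0) (h1 : y 1 = 0)
    (hne : ∃ k < n, y (k + 2) ≠ 0) : ∃ k < n, secondDiff y k ≠ 0 := by
  by_contra! h
  obtain ⟨k, hk, hy⟩ := hne
  have key : ∀ k, k ≤ n → y k = 0 ∧ y (k + 1) = 0 := by
    intro k
    induction k with
    | zero => exact fun _ => ⟨h0, h1⟩
    | succ k ih =>
      intro hk
      have h' := h k (by omega)
      obtain ⟨e0, e1⟩ := ih (by omega)
      rw [secondDiff, e0, e1] at h'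
      exact ⟨e1, by linarith⟩
  exact hy (key (k + 1) hk).2

theorem sum_secondDiff_sq {y : ℕ → ℝ} {n : ℕ} {μ : ℝ} (h0 : y 0 = 0) (h1 : y 1 = 0)
    (h2 : y (n + 2) = 0) (h3 : y (n + 3) = 0) (h : ∀ k < n, fourthDiff y k = μ * y (k + 2)) :
    ∑ k ∈ Finset.range (n + 2), secondDiff y k ^ 2 =
      μ * ∑ k ∈ Finset.range n, y (k + 2) ^ 2 := by
  rw [← sum_mul_fourthDiff_self h0 h1 h2 h3, Finset.mul_sum]
  refine Finset.sum_congr rfl fun k hk => ?_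
  rw [h k (Finset.mem_range.1 hk)]
  ring

theorem spectrum_T_pos {n : ℕ} {μ : ℝ} (h : μ ∈ spectrum ℝ (T n)) : 0 < μ := by
  obtain ⟨y, h0, h1, h2, h3, hne, h⟩ := (mem_spectrum_T_iff μ).1 h
  have e := sum_secondDiff_sq h0 h1 h2 h3 h
  obtain ⟨k, hk, hd⟩ := secondDiff_ne_zero h0 h1 hne
  have hpos : 0 < ∑ k ∈ Finset.range (n + 2), secondDiff y k ^ 2 :=
    Finset.sum_pos' (fun _ _ => sq_nonneg _)
      ⟨k, Finset.mem_range.2 (by omega), by positivity⟩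
  have hnn : 0 ≤ ∑ k ∈ Finset.range n, y (k + 2) ^ 2 := Finset.sum_nonneg fun _ _ => sq_nonneg _
  rw [e] at hpos
  exact pos_of_mul_pos_left hpos hnn

theorem spectrum_T_le {n : ℕ} {μ : ℝ} (h : μ ∈ spectrum ℝ (T n)) : μ ≤ 16 := by
  obtain ⟨y, h0, h1, h2, h3, ⟨k, hk, hne⟩, h⟩ := (mem_spectrum_T_iff μ).1 h
  have e := sum_secondDiff_sq h0 h1 h2 h3 h
  have hpos : 0 < ∑ k ∈ Finset.range n, y (k + 2) ^ 2 :=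
    Finset.sum_pos' (fun _ _ => sq_nonneg _) ⟨k, Finset.mem_range.2 hk, by positivity⟩
  have b : ∑ k ∈ Finset.range (n + 2), secondDiff y k ^ 2 ≤
      ∑ k ∈ Finset.range (n + 2), (4 * y k ^ 2 + 8 * y (k + 1) ^ 2 + 4 * y (k + 2) ^ 2) := by
    refine Finset.sum_le_sum fun k _ => ?_
    rw [secondDiff]
    nlinarith [sq_nonneg (y k + y (k + 1)), sq_nonneg (y (k + 1) + y (k + 2)),
      sq_nonneg (y k - y (k + 2))]
  have s0 : ∑ k ∈ Finset.range (n + 2), y k ^ 2 = ∑ k ∈ Finset.range n, y (k + 2) ^ 2 := by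
    rw [Finset.sum_range_succ', Finset.sum_range_succ']
    simp [h0, h1]
  have s1 : ∑ k ∈ Finset.range (n + 2), y (k + 1) ^ 2 = ∑ k ∈ Finset.range n, y (k + 2) ^ 2 := by
    rw [Finset.sum_range_succ, Finset.sum_range_succ']
    simp [h1, h2]
  have s2 : ∑ k ∈ Finset.range (n + 2), y (k + 2) ^ 2 = ∑ k ∈ Finset.range n, y (k + 2) ^ 2 := by
    rw [Finset.sum_range_succ, Finset.sum_range_succ]
    simp [h2, h3]
  rw [Finset.sum_add_distrib, Finset.sum_add_distrib, ← Finset.mul_sum, ← Finset.mul_sum,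
    ← Finset.mul_sum, s0, s1, s2, e] at b
  exact le_of_mul_le_mul_right (by linarith) hpos

theorem opNorm2_le {n : ℕ} {A : Matrix (Fin n) (Fin n) ℝ} (hA : A.IsHermitian) {r : ℝ}
    (hr : 0 ≤ r) (h : ∀ μ ∈ spectrum ℝ A, |μ| ≤ r) : opNorm2 A ≤ r := by
  refine ContinuousLinearMap.opNorm_le_bound _ hr fun x => ?_
  refine le_of_sq_le_sq ?_ (by positivity)
  rw [← hA.eigenvectorBasis.sum_sq_norm_inner_right, mul_pow,
    ← hA.eigenvectorBasis.sum_sq_norm_inner_right x, Finset.mul_sum]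
  refine Finset.sum_le_sum fun i _ => ?_
  have e : inner ℝ (hA.eigenvectorBasis i) (Matrix.toEuclideanCLM (𝕜 := ℝ) A x) =
      hA.eigenvalues i * inner ℝ (hA.eigenvectorBasis i) x := by
    have hsymm := (Matrix.isSymmetric_toEuclideanLin_iff.2 hA) (hA.eigenvectorBasis i) x
    have hv : Matrix.toEuclideanLin A (hA.eigenvectorBasis i) =
        hA.eigenvalues i • hA.eigenvectorBasis i := by
      have := hA.mulVec_eigenvectorBasis i
      rw [Matrix.toLpLin_apply, this]
      rfl
    rw [hv, inner_smul_left] at hsymm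
    exact hsymm.symm
  rw [e, norm_mul, mul_pow, Real.norm_eq_abs]
  gcongr
  exact h _ (hA.spectrum_real_eq_range_eigenvalues ▸ Set.mem_range_self i)

theorem abs_le_opNorm2 {n : ℕ} {A : Matrix (Fin n) (Fin n) ℝ} {μ : ℝ}
    (h : μ ∈ spectrum ℝ A) : |μ| ≤ opNorm2 A := by
  obtain ⟨x, hx, e⟩ := (mem_spectrum_iff_exists A μ).1 h
  have hle := (Matrix.toEuclideanCLM (𝕜 := ℝ) A).le_opNorm (WithLp.toLp 2 x)
  rw [Matrix.toEuclideanCLM_toLp, e, WithLp.toLp_smul, norm_smul] at hle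
  exact le_of_mul_le_mul_right hle (norm_pos_iff.2 (by simpa using hx))

theorem dotProduct_mulVec_le {n : ℕ} (A : Matrix (Fin n) (Fin n) ℝ) (x : Fin n → ℝ) :
    x ⬝ᵥ A.mulVec x ≤ opNorm2 A * (x ⬝ᵥ x) := by
  have h := real_inner_le_norm (WithLp.toLp 2 x)
    (Matrix.toEuclideanCLM (𝕜 := ℝ) A (WithLp.toLp 2 x))
  have h' := (Matrix.toEuclideanCLM (𝕜 := ℝ) A).le_opNorm (WithLp.toLp 2 x)
  rw [Matrix.inner_toEuclideanCLM] at h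
  have e : x ⬝ᵥ x = ‖WithLp.toLp 2 x‖ ^ 2 := by
    rw [EuclideanSpace.norm_sq_eq, dotProduct]
    simp [sq]
  rw [e, opNorm2]
  nlinarith [norm_nonneg (WithLp.toLp 2 x)]

theorem opNorm2_T_lower (n : ℕ) : 16 * ((n : ℝ) - 2) ≤ opNorm2 (T n) * n := by
  let y : ℕ → ℝ := fun k => if 2 ≤ k ∧ k < n + 2 then (-1) ^ k else 0
  have h0 : y 0 = 0 := by simp [y]
  have h1 : y 1 = 0 := by simp [y]
  have h2 : y (n + 2) = 0 := by simp [y]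
  have h3 : y (n + 3) = 0 := by simp [y]
  have h := dotProduct_mulVec_le (T n) (fun j : Fin n => y (j + 2))
  have e1 : (fun j : Fin n => y (j + 2)) ⬝ᵥ (fun j : Fin n => y (j + 2)) = n := by
    rw [dotProduct, Finset.sum_congr rfl (g := fun _ => (1 : ℝ))]
    · simp
    · intro i _
      simp only [y]
      rw [if_pos ⟨by omega, by omega⟩, ← mul_pow]
      simp
  have e2 : (fun j : Fin n => y (j + 2)) ⬝ᵥ (T n).mulVec (fun j : Fin n => y (j + 2)) =
      ∑ k ∈ Finset.range (n + 2), secondDiff y k ^ 2 := by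
    rw [← sum_mul_fourthDiff_self h0 h1 h2 h3, dotProduct,
      ← Fin.sum_univ_eq_sum_range (fun k => y (k + 2) * fourthDiff y k)]
    exact Finset.sum_congr rfl fun i _ => by rw [T_mulVec h0 h1 h2 h3]
  have e3 : ∑ k ∈ Finset.Ico 2 n, (16 : ℝ) ≤ ∑ k ∈ Finset.range (n + 2), secondDiff y k ^ 2 := by
    calc ∑ k ∈ Finset.Ico 2 n, (16 : ℝ) = ∑ k ∈ Finset.Ico 2 n, secondDiff y k ^ 2 := by
          refine Finset.sum_congr rfl fun k hk => ?_
          rw [Finset.mem_Ico] at hk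
          simp only [secondDiff, y]
          rw [if_pos (by omega), if_pos (by omega), if_pos (by omega)]
          have : ((-1 : ℝ) ^ k) ^ 2 = 1 := by rw [← pow_mul, mul_comm, pow_mul]; simp
          rw [pow_succ, pow_add]
          linear_combination (-16) * this
      _ ≤ _ := Finset.sum_le_sum_of_subset_of_nonneg
          (fun k hk => by rw [Finset.mem_Ico] at hk; exact Finset.mem_range.2 (by omega))
          (fun _ _ _ => sq_nonneg _)
  rw [e1, e2] at h
  refine le_trans ?_ (e3.trans h)
  rw [Finset.sum_const, Nat.card_Ico, nsmul_eq_mul]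
  have : (n : ℝ) - 2 ≤ ((n - 2 : ℕ) : ℝ) := by
    rw [sub_le_iff_le_add]
    exact_mod_cast (by omega : n ≤ n - 2 + 2)
  linarith

/-- A matrix of size `n` has no more than `n` eigenvalues. -/
theorem exists_eq_of_mem_spectrum {n : ℕ} {A : Matrix (Fin n) (Fin n) ℝ} (hA : A.IsHermitian)
    {l : ℕ → ℝ} (hmono : ∀ j k, 1 ≤ j → j < k → k ≤ n → l j < l k)
    (hspec : ∀ j, 1 ≤ j → j ≤ n → l j ∈ spectrum ℝ A) {μ : ℝ} (hμ : μ ∈ spectrum ℝ A) :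
    ∃ j, 1 ≤ j ∧ j ≤ n ∧ μ = l j := by
  have hinj : Set.InjOn l (Finset.Icc 1 n) := by
    intro a ha b hb hab
    simp only [Finset.coe_Icc, Set.mem_Icc] at ha hb
    rcases lt_trichotomy a b with h | h | h
    · exact absurd hab (hmono a b ha.1 h hb.2).ne
    · exact h
    · exact absurd hab (hmono b a hb.1 h ha.2).ne'
  have hsub : (Finset.Icc 1 n).image l ⊆ Finset.univ.image hA.eigenvalues := by
    intro x hx
    obtain ⟨j, hj, rfl⟩ := Finset.mem_image.1 hx
    rw [Finset.mem_Icc] at hj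
    have := hspec j hj.1 hj.2
    rw [hA.spectrum_real_eq_range_eigenvalues] at this
    simpa using this
  have hcard : (Finset.univ.image hA.eigenvalues).card ≤ ((Finset.Icc 1 n).image l).card := by
    rw [Finset.card_image_of_injOn hinj]
    simpa using Finset.card_image_le (s := Finset.univ) (f := hA.eigenvalues)
  have heq := Finset.eq_of_subset_of_card_le hsub hcard
  have hmem : μ ∈ Finset.univ.image hA.eigenvalues := by
    rw [hA.spectrum_real_eq_range_eigenvalues] at hμ
    simpa using hμ
  rw [← heq] at hmem
  obtain ⟨j, hj, rfl⟩ := Finset.mem_image.1 hmem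
  rw [Finset.mem_Icc] at hj
  exact ⟨j, hj.1, hj.2, rfl⟩

theorem isUnit_T (n : ℕ) : IsUnit (T n) := by
  by_contra h
  exact (spectrum_T_pos (spectrum.zero_mem ℝ h)).false

theorem opNorm2_T_eq {n : ℕ} {M : ℝ} (hM : M ∈ spectrum ℝ (T n))
    (h : ∀ μ ∈ spectrum ℝ (T n), μ ≤ M) : opNorm2 (T n) = M := by
  have hpos := spectrum_T_pos hM
  refine le_antisymm (opNorm2_le (T_isHermitian n) hpos.le fun μ hμ => ?_) ?_
  · rw [abs_of_pos (spectrum_T_pos hμ)]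
    exact h μ hμ
  · exact (le_abs_self M).trans (abs_le_opNorm2 hM)

theorem opNorm2_T_inv_eq {n : ℕ} {m : ℝ} (hm : m ∈ spectrum ℝ (T n))
    (h : ∀ μ ∈ spectrum ℝ (T n), m ≤ μ) : opNorm2 (T n)⁻¹ = m⁻¹ := by
  have hpos := spectrum_T_pos hm
  obtain ⟨u, hu⟩ := isUnit_T n
  have hinv : (T n)⁻¹ = ((u⁻¹ : (Matrix (Fin n) (Fin n) ℝ)ˣ) : Matrix (Fin n) (Fin n) ℝ) := by
    rw [← hu, Matrix.coe_units_inv]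
  refine le_antisymm (opNorm2_le (T_isHermitian n).inv (by positivity) fun μ hμ => ?_) ?_
  · have hne : μ ≠ 0 := by
      rintro rfl
      rw [hinv] at hμ
      exact (spectrum.zero_notMem ℝ (u⁻¹).isUnit) hμ
    have hmem : μ⁻¹ ∈ spectrum ℝ (T n) := by
      rw [hinv] at hμ
      have := (spectrum.inv_mem_iff (r := Units.mk0 μ hne) (a := u⁻¹)).1 hμ
      rw [inv_inv, hu] at this
      simpa using this
    have hp := spectrum_T_pos hmem
    rw [abs_of_pos (inv_pos.1 hp)]
    exact (le_inv_comm₀ hpos (inv_pos.1 hp)).1 (h _ hmem)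
  · have hmem : m⁻¹ ∈ spectrum ℝ (T n)⁻¹ := by
      rw [hinv]
      rw [← hu] at hm
      exact (spectrum.inv_mem_iff (r := Units.mk0 m hpos.ne') (a := u)).1 hm
    exact (le_abs_self _).trans (abs_le_opNorm2 hmem)

theorem fourthDiff_cos (p c : ℝ) (k : ℕ) :
    fourthDiff (fun k : ℕ => cos (p * (2 * k - c))) k =
      (2 * sin p) ^ 4 * cos (p * (2 * (k + 2 : ℕ) - c)) := by
  have e2 : cos (2 * p) = 1 - 2 * sin p ^ 2 := by rw [cos_two_mul, cos_sq']; ring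
  have e4 : cos (2 * (2 * p)) = 1 - 8 * sin p ^ 2 + 8 * sin p ^ 4 := by
    rw [cos_two_mul, e2]; ring
  simp only [fourthDiff]
  push_cast
  set u := p * (2 * ((k : ℝ) + 2) - c) with hu
  rw [show p * (2 * (k : ℝ) - c) = u - 2 * (2 * p) by rw [hu]; ring,
    show p * (2 * ((k : ℝ) + 1) - c) = u - 2 * p by rw [hu]; ring,
    show p * (2 * ((k : ℝ) + 3) - c) = u + 2 * p by rw [hu]; ring,
    show p * (2 * ((k : ℝ) + 4) - c) = u + 2 * (2 * p) by rw [hu]; ring,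
    cos_sub, cos_sub, cos_add, cos_add, e2, e4]
  ring

theorem fourthDiff_sin (p c : ℝ) (k : ℕ) :
    fourthDiff (fun k : ℕ => sin (p * (2 * k - c))) k =
      (2 * sin p) ^ 4 * sin (p * (2 * (k + 2 : ℕ) - c)) := by
  have e2 : cos (2 * p) = 1 - 2 * sin p ^ 2 := by rw [cos_two_mul, cos_sq']; ring
  have e4 : cos (2 * (2 * p)) = 1 - 8 * sin p ^ 2 + 8 * sin p ^ 4 := by
    rw [cos_two_mul, e2]; ring
  simp only [fourthDiff]
  push_cast
  set u := p * (2 * ((k : ℝ) + 2) - c) with hu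
  rw [show p * (2 * (k : ℝ) - c) = u - 2 * (2 * p) by rw [hu]; ring,
    show p * (2 * ((k : ℝ) + 1) - c) = u - 2 * p by rw [hu]; ring,
    show p * (2 * ((k : ℝ) + 3) - c) = u + 2 * p by rw [hu]; ring,
    show p * (2 * ((k : ℝ) + 4) - c) = u + 2 * (2 * p) by rw [hu]; ring,
    sin_sub, sin_sub, sin_add, sin_add, e2, e4]
  ring

theorem fourthDiff_cosh (q c : ℝ) (k : ℕ) :
    fourthDiff (fun k : ℕ => cosh (q * (2 * k - c))) k =
      (2 * sinh q) ^ 4 * cosh (q * (2 * (k + 2 : ℕ) - c)) := by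
  have e2 : cosh (2 * q) = 1 + 2 * sinh q ^ 2 := by rw [cosh_two_mul, cosh_sq]; ring
  have e4 : cosh (2 * (2 * q)) = 1 + 8 * sinh q ^ 2 + 8 * sinh q ^ 4 := by
    rw [cosh_two_mul, sinh_sq, e2]; ring
  simp only [fourthDiff]
  push_cast
  set u := q * (2 * ((k : ℝ) + 2) - c) with hu
  rw [show q * (2 * (k : ℝ) - c) = u - 2 * (2 * q) by rw [hu]; ring,
    show q * (2 * ((k : ℝ) + 1) - c) = u - 2 * q by rw [hu]; ring,
    show q * (2 * ((k : ℝ) + 3) - c) = u + 2 * q by rw [hu]; ring,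
    show q * (2 * ((k : ℝ) + 4) - c) = u + 2 * (2 * q) by rw [hu]; ring,
    cosh_sub, cosh_sub, cosh_add, cosh_add, e2, e4]
  ring

theorem fourthDiff_sinh (q c : ℝ) (k : ℕ) :
    fourthDiff (fun k : ℕ => sinh (q * (2 * k - c))) k =
      (2 * sinh q) ^ 4 * sinh (q * (2 * (k + 2 : ℕ) - c)) := by
  have e2 : cosh (2 * q) = 1 + 2 * sinh q ^ 2 := by rw [cosh_two_mul, cosh_sq]; ring
  have e4 : cosh (2 * (2 * q)) = 1 + 8 * sinh q ^ 2 + 8 * sinh q ^ 4 := by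
    rw [cosh_two_mul, sinh_sq, e2]; ring
  simp only [fourthDiff]
  push_cast
  set u := q * (2 * ((k : ℝ) + 2) - c) with hu
  rw [show q * (2 * (k : ℝ) - c) = u - 2 * (2 * q) by rw [hu]; ring,
    show q * (2 * ((k : ℝ) + 1) - c) = u - 2 * q by rw [hu]; ring,
    show q * (2 * ((k : ℝ) + 3) - c) = u + 2 * q by rw [hu]; ring,
    show q * (2 * ((k : ℝ) + 4) - c) = u + 2 * (2 * q) by rw [hu]; ring,
    sinh_sub, sinh_sub, sinh_add, sinh_add, e2, e4]
  ring

/-- An eigenvalue `(2 sin p)^4 = (2 sinh q)^4` makes one of the two characteristic determinants,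
of the even or of the odd solutions, vanish. -/
theorem not_mem_spectrum_of_det_ne_zero {n : ℕ} {p q : ℝ} (hpq : sinh q = sin p)
    (heven : cos (p * (n + 1)) * cosh (q * (n + 3)) - cos (p * (n + 3)) * cosh (q * (n + 1)) ≠ 0)
    (hodd : sin (p * (n + 1)) * sinh (q * (n + 3)) - sin (p * (n + 3)) * sinh (q * (n + 1)) ≠ 0) :
    (2 * sin p) ^ 4 ∉ spectrum ℝ (T n) := by
  intro hmem
  obtain ⟨y, h0, h1, h2, h3, ⟨k, hk, hne⟩, h⟩ := (mem_spectrum_T_iff _).1 hmem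
  have b1 := boundary_identity h0 h1 h2 h3 h (fourthDiff_cos p (n + 3))
  have b2 := boundary_identity h0 h1 h2 h3 h (fourthDiff_sin p (n + 3))
  have b3 := boundary_identity h0 h1 h2 h3 (by rwa [← hpq] at h) (fourthDiff_cosh q (n + 3))
  have b4 := boundary_identity h0 h1 h2 h3 (by rwa [← hpq] at h) (fourthDiff_sinh q (n + 3))
  have r0 (p : ℝ) : p * (2 * (0 : ℕ) - ((n : ℝ) + 3)) = -(p * (n + 3)) := by push_cast; ring
  have r1 (p : ℝ) : p * (2 * (1 : ℕ) - ((n : ℝ) + 3)) = -(p * (n + 1)) := by push_cast; ring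
  have r2 (p : ℝ) : p * (2 * (n + 2 : ℕ) - ((n : ℝ) + 3)) = p * (n + 1) := by push_cast; ring
  have r3 (p : ℝ) : p * (2 * (n + 3 : ℕ) - ((n : ℝ) + 3)) = p * (n + 3) := by push_cast; ring
  simp only [r0, r1, r2, r3, cos_neg, sin_neg, cosh_neg, sinh_neg] at b1 b2 b3 b4
  have s1 : y 2 + y (n + 1) = 0 := by
    refine (mul_eq_zero.1 ?_).resolve_left heven
    linear_combination cos (p * (n + 1)) * b3 - cosh (q * (n + 1)) * b1
  have s2 : y 3 - 4 * y 2 + (y n - 4 * y (n + 1)) = 0 := by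
    refine (mul_eq_zero.1 ?_).resolve_left heven
    linear_combination cosh (q * (n + 3)) * b1 - cos (p * (n + 3)) * b3
  have s3 : y 2 - y (n + 1) = 0 := by
    refine (mul_eq_zero.1 ?_).resolve_left hodd
    linear_combination -sin (p * (n + 1)) * b4 + sinh (q * (n + 1)) * b2
  have s4 : y 3 - 4 * y 2 - (y n - 4 * y (n + 1)) = 0 := by
    refine (mul_eq_zero.1 ?_).resolve_left hodd
    linear_combination -sinh (q * (n + 3)) * b2 + sin (p * (n + 3)) * b4
  have key : ∀ k, k ≤ n → y k = 0 ∧ y (k + 1) = 0 ∧ y (k + 2) = 0 ∧ y (k + 3) = 0 := by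
    intro k
    induction k with
    | zero => exact fun _ => ⟨h0, h1, by linarith, by linarith⟩
    | succ k ih =>
      intro hk
      obtain ⟨e0, e1, e2, e3⟩ := ih (by omega)
      have h' := h k (by omega)
      rw [fourthDiff, e0, e1, e2, e3] at h'
      exact ⟨e1, e2, e3, by linarith⟩
  exact hne (key k hk.le).2.2.1

/-- The characteristic function of the clamped beam, whose first positive zero is `α₁ / 2`. -/
noncomputable def beam (t : ℝ) : ℝ := cos t * sinh t + sin t * cosh t

theorem hasDerivAt_beam (t : ℝ) : HasDerivAt beam (2 * (cos t * cosh t)) t := by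
  have h := ((hasDerivAt_cos t).mul (hasDerivAt_sinh t)).add
    ((hasDerivAt_sin t).mul (hasDerivAt_cosh t))
  exact h.congr_deriv (by ring)

theorem strictAntiOn_beam : StrictAntiOn beam (Icc (π / 2) π) := by
  refine strictAntiOn_of_deriv_neg (convex_Icc _ _)
    (fun t _ => (hasDerivAt_beam t).continuousAt.continuousWithinAt) fun t ht => ?_
  rw [interior_Icc] at ht
  rw [(hasDerivAt_beam t).deriv]
  have := cos_neg_of_pi_div_two_lt_of_lt ht.1 (by linarith [ht.2, pi_pos])
  nlinarith [cosh_pos t, mul_neg_of_neg_of_pos this (cosh_pos t)]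

theorem even_det_eq (t p e q : ℝ) :
    cos (t - p) * cosh (e + q) - cos (t + p) * cosh (e - q) =
      2 * (cos t * cos p * (sinh e * sinh q) + sin t * sin p * (cosh e * cosh q)) := by
  rw [cos_sub, cos_add, cosh_add, cosh_sub]
  ring

theorem even_det_pos {t p e q t₀ : ℝ} (hpq : sinh q = sin p) (hp : 0 < sin p)
    (hcp : 0 ≤ cos p) (hq : 0 < q) (he : 0 ≤ e) (het : e ≤ t) (ht0 : 0 < t) (ht : t ≤ t₀) (h₀ : t₀ ∈ Ioo (π / 2) π)
    (hb : beam t₀ = 0) :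
    0 < cos (t - p) * cosh (e + q) - cos (t + p) * cosh (e - q) := by
  rw [even_det_eq, hpq]
  have hsin : 0 < sin t := sin_pos_of_pos_of_lt_pi ht0 (ht.trans_lt h₀.2)
  have hcq : 1 < cosh q := one_lt_cosh.2 hq.ne'
  have hce := cosh_pos e
  have hse : 0 ≤ sinh e := sinh_nonneg_iff.2 he
  have hlt : sin t * cosh e < sin t * cosh e * cosh q := by
    have : 0 < sin t * cosh e := by positivity
    nlinarith
  suffices h : 0 ≤ cos t * cos p * sinh e + sin t * cosh e by
    have : 0 < cos t * cos p * sinh e + sin t * cosh e * cosh q := by linarith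
    have := mul_pos hp this
    linarith
  rcases le_or_gt (π / 2) t with h | h
  · have hcos : cos t ≤ 0 := cos_nonpos_of_pi_div_two_le_of_le h (by linarith [h₀.2, pi_pos])
    have hbt : 0 ≤ beam t := by
      rw [← hb]
      exact strictAntiOn_beam.antitoneOn ⟨h, by linarith [h₀.2]⟩ ⟨h₀.1.le, h₀.2.le⟩ ht
    have hct := cosh_pos t
    have hsub : 0 ≤ sinh t * cosh e - cosh t * sinh e := by
      rw [← sinh_sub]
      exact sinh_nonneg_iff.2 (by linarith)
    have h1 : cos t * sinh e ≤ cos t * cos p * sinh e := by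
      have := mul_nonneg (mul_nonneg (neg_nonneg.2 hcos) hse) (sub_nonneg.2 (cos_le_one p))
      linarith
    have h2 : 0 ≤ cosh t * (cos t * sinh e + sin t * cosh e) := by
      have h3 := mul_nonneg hce.le hbt
      have h4 := mul_nonneg (neg_nonneg.2 hcos) hsub
      rw [beam] at h3
      linarith
    have := nonneg_of_mul_nonneg_right h2 hct
    linarith
  · have hcos : 0 ≤ cos t := cos_nonneg_of_neg_pi_div_two_le_of_le (by linarith) h.le
    positivity

theorem convexOn_sinh : ConvexOn ℝ (Ici 0) sinh := by
  refine MonotoneOn.convexOn_of_deriv (convex_Ici 0) continuous_sinh.continuousOn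
    differentiable_sinh.differentiableOn ?_
  rw [Real.deriv_sinh]
  exact cosh_strictMonoOn.monotoneOn.mono interior_subset

theorem odd_det_pos {n : ℕ} (hn : 1 ≤ n) {p q : ℝ} (hp : 0 < p) (hq : 0 < q)
    (ht : p * (n + 2) < π) :
    0 < sin (p * (n + 1)) * sinh (q * (n + 3)) - sin (p * (n + 3)) * sinh (q * (n + 1)) := by
  have hn' : (1 : ℝ) ≤ n := by exact_mod_cast hn
  have hsin : 0 < sin (p * (n + 1)) := sin_pos_of_pos_of_lt_pi (by positivity) (by nlinarith)
  have hs1 : 0 < sinh (q * (n + 1)) := sinh_pos_iff.2 (by positivity)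
  have hs3 : 0 < sinh (q * (n + 3)) := sinh_pos_iff.2 (by positivity)
  rcases le_or_gt (p * (n + 3)) π with h | h
  · have h1 : ((n : ℝ) + 1) * sin (p * (n + 3)) < (n + 3) * sin (p * (n + 1)) := by
      have hc := strictConcaveOn_sin_Icc.2 (⟨le_rfl, pi_pos.le⟩ : (0 : ℝ) ∈ Icc 0 π)
        (⟨by positivity, h⟩ : p * (n + 3) ∈ Icc 0 π) (by positivity)
        (by positivity : (0 : ℝ) < 2 / (n + 3)) (by positivity : (0 : ℝ) < (n + 1) / (n + 3))
        (by field_simp; ring)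
      simp only [smul_eq_mul, sin_zero, mul_zero, zero_add] at hc
      rw [show ((n : ℝ) + 1) / (n + 3) * (p * (n + 3)) = p * (n + 1) by field_simp,
        div_mul_eq_mul_div, div_lt_iff₀ (by positivity)] at hc
      linarith
    have h2 : ((n : ℝ) + 3) * sinh (q * (n + 1)) ≤ (n + 1) * sinh (q * (n + 3)) := by
      have hc := convexOn_sinh.2 self_mem_Ici (mem_Ici.2 (by positivity) : q * (n + 3) ∈ Ici 0)
        (by positivity : (0 : ℝ) ≤ 2 / (n + 3)) (by positivity : (0 : ℝ) ≤ (n + 1) / (n + 3))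
        (by field_simp; ring)
      simp only [smul_eq_mul, sinh_zero, mul_zero, zero_add] at hc
      rw [show ((n : ℝ) + 1) / (n + 3) * (q * (n + 3)) = q * (n + 1) by field_simp,
        div_mul_eq_mul_div, le_div_iff₀ (by positivity)] at hc
      linarith
    have h3 := mul_lt_mul_of_pos_right h1 hs1
    have h4 := mul_le_mul_of_nonneg_left h2 hsin.le
    have h5 : 0 < ((n : ℝ) + 1) *
        (sin (p * (n + 1)) * sinh (q * (n + 3)) - sin (p * (n + 3)) * sinh (q * (n + 1))) := by
      linarith
    exact pos_of_mul_pos_right h5 (by positivity)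
  · have : sin (p * (n + 3)) ≤ 0 := by
      have := sin_nonneg_of_nonneg_of_le_pi (x := p * (n + 3) - π) (by linarith) (by nlinarith)
      rw [sin_sub_pi] at this
      linarith
    nlinarith [mul_pos hsin hs3, mul_nonneg (neg_nonneg.2 this) hs1.le]

theorem arsinh_sin_pos {p : ℝ} (hp : 0 < p) (hp' : p < π) : 0 < arsinh (sin p) :=
  arsinh_pos_iff.2 (sin_pos_of_pos_of_lt_pi hp hp')

theorem arsinh_sin_le {p : ℝ} (hp : 0 ≤ p) : arsinh (sin p) ≤ p := by
  rw [← sinh_le_sinh, sinh_arsinh]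
  exact (sin_le hp).trans (self_le_sinh_iff.2 hp)

/-- The characteristic determinant of the even solutions at the eigenvalue candidate
`(2 sin (t / (n + 2)))^4`. -/
noncomputable def evenDet (n : ℕ) (t : ℝ) : ℝ :=
  cos (t / (n + 2) * (n + 1)) * cosh (arsinh (sin (t / (n + 2))) * (n + 3)) -
    cos (t / (n + 2) * (n + 3)) * cosh (arsinh (sin (t / (n + 2))) * (n + 1))

theorem evenDet_eq (n : ℕ) (t : ℝ) :
    evenDet n t = 2 * sin (t / (n + 2)) *
      (cos t * cos (t / (n + 2)) * sinh ((n + 2) * arsinh (sin (t / (n + 2)))) +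
        sin t * (cosh ((n + 2) * arsinh (sin (t / (n + 2)))) *
          cosh (arsinh (sin (t / (n + 2)))))) := by
  have hn : (n : ℝ) + 2 ≠ 0 := by positivity
  have h := even_det_eq t (t / (n + 2)) ((n + 2) * arsinh (sin (t / (n + 2))))
    (arsinh (sin (t / (n + 2))))
  have e1 : t - t / (n + 2) = t / (n + 2) * (n + 1) := by field_simp; ring
  have e2 : t + t / (n + 2) = t / (n + 2) * (n + 3) := by field_simp; ring
  rw [e1, e2, sinh_arsinh] at h
  rw [evenDet]
  convert h using 1
  · ring_nf
  · ring

theorem evenDet_pos {n : ℕ} (hn : 1 ≤ n) {t t₀ : ℝ} (ht : 0 < t) (htt : t ≤ t₀)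
    (h₀ : t₀ ∈ Ioo (π / 2) π) (hb : beam t₀ = 0) : 0 < evenDet n t := by
  have hn' : (1 : ℝ) ≤ n := by exact_mod_cast hn
  have hp : 0 < t / (n + 2) := by positivity
  have hp3 : t / (n + 2) < π / 2 := by
    rw [div_lt_iff₀ (by positivity)]
    nlinarith [h₀.2, pi_pos]
  have hq := arsinh_sin_pos hp (by linarith [pi_pos])
  have h := even_det_pos (sinh_arsinh (sin (t / (n + 2))))
    (sin_pos_of_pos_of_lt_pi hp (by linarith [pi_pos]))
    (cos_nonneg_of_neg_pi_div_two_le_of_le (by linarith [pi_pos]) hp3.le) hq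
    (e := (n + 2) * arsinh (sin (t / (n + 2)))) (by positivity)
    (by
      have := mul_le_mul_of_nonneg_left (arsinh_sin_le hp.le) (by positivity : (0 : ℝ) ≤ n + 2)
      rwa [mul_div_cancel₀ _ (by positivity)] at this)
    ht htt h₀ hb
  rw [evenDet_eq]
  rw [even_det_eq, sinh_arsinh] at h
  linarith

theorem not_mem_spectrum {n : ℕ} (hn : 1 ≤ n) {t t₀ : ℝ} (ht : 0 < t) (htt : t ≤ t₀)
    (h₀ : t₀ ∈ Ioo (π / 2) π) (hb : beam t₀ = 0) :
    (2 * sin (t / (n + 2))) ^ 4 ∉ spectrum ℝ (T n) := by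
  have hn' : (1 : ℝ) ≤ n := by exact_mod_cast hn
  have hp : 0 < t / (n + 2) := by positivity
  have hp3 : t / (n + 2) < π := by
    rw [div_lt_iff₀ (by positivity)]
    nlinarith [h₀.2, pi_pos]
  refine not_mem_spectrum_of_det_ne_zero (sinh_arsinh _) (evenDet_pos hn ht htt h₀ hb).ne'
    (odd_det_pos hn hp (arsinh_sin_pos hp hp3) ?_).ne'
  rw [div_mul_cancel₀ _ (by positivity)]
  linarith [h₀.2]

theorem lt_of_mem_spectrum {n : ℕ} (hn : 1 ≤ n) {t₀ μ : ℝ}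
    (h₀ : t₀ ∈ Ioo (π / 2) π) (hb : beam t₀ = 0) (hμ : μ ∈ spectrum ℝ (T n)) :
    (2 * sin (t₀ / (n + 2))) ^ 4 < μ := by
  by_contra! h
  have hcont : ContinuousOn (fun t : ℝ => (2 * sin (t / (n + 2))) ^ 4) (Icc 0 t₀) := by
    fun_prop
  obtain ⟨t, ht, e⟩ := intermediate_value_Ioc (by linarith [h₀.1, pi_pos]) hcont
    ⟨by simpa using spectrum_T_pos hμ, h⟩
  exact not_mem_spectrum hn ht.1 ht.2 h₀ hb (by simpa [e] using hμ)

theorem mem_spectrum_of_evenDet_eq_zero {n : ℕ} (hn : 1 ≤ n) {t : ℝ}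
    (h : evenDet n t = 0) (h' : t / (n + 2) ∈ Ioo 0 (π / 2))
    (hcos : cos (t / (n + 2) * (n + 1)) ≤ 0) :
    (2 * sin (t / (n + 2))) ^ 4 ∈ spectrum ℝ (T n) := by
  set p := t / (n + 2) with hp
  rw [evenDet, ← hp] at h
  set q := arsinh (sin p) with hq
  have hqs : sinh q = sin p := sinh_arsinh _
  rw [mem_spectrum_T_iff]
  have r0 (p : ℝ) : p * (2 * (0 : ℕ) - ((n : ℝ) + 3)) = -(p * (n + 3)) := by push_cast; ring
  have r1 (p : ℝ) : p * (2 * (1 : ℕ) - ((n : ℝ) + 3)) = -(p * (n + 1)) := by push_cast; ring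
  have r2 (p : ℝ) : p * (2 * (n + 2 : ℕ) - ((n : ℝ) + 3)) = p * (n + 1) := by push_cast; ring
  have r3 (p : ℝ) : p * (2 * (n + 3 : ℕ) - ((n : ℝ) + 3)) = p * (n + 3) := by push_cast; ring
  refine ⟨fun k => cosh (q * (n + 1)) * cos (p * (2 * k - (n + 3))) -
    cos (p * (n + 1)) * cosh (q * (2 * k - (n + 3))), ?_, ?_, ?_, ?_, ?_, ?_⟩
  · simp only [r0, cos_neg, cosh_neg]
    linarith
  · simp only [r1, cos_neg, cosh_neg]
    ring
  · simp only [r2]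
    ring
  · simp only [r3]
    linarith
  · refine ⟨n / 2, by omega, ne_of_gt ?_⟩
    have hc : 0 < cos (p * (2 * (n / 2 + 2 : ℕ) - (n + 3))) := by
      have hmod : (2 * ((n / 2 : ℕ) : ℝ)) + ((n % 2 : ℕ) : ℝ) = n := by
        exact_mod_cast Nat.div_add_mod n 2
      rcases Nat.mod_two_eq_zero_or_one n with h2 | h2 <;> rw [h2] at hmod <;> push_cast at hmod ⊢
      · rw [show p * (2 * (((n / 2 : ℕ) : ℝ) + 2) - (n + 3)) = p by linear_combination p * hmod]
        exact cos_pos_of_mem_Ioo ⟨by linarith [h'.1, pi_pos], h'.2⟩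
      · rw [show p * (2 * (((n / 2 : ℕ) : ℝ) + 2) - (n + 3)) = 0 by linear_combination p * hmod]
        simp
    have h1 := mul_pos (cosh_pos (q * (n + 1))) hc
    have h2 := mul_nonneg (neg_nonneg.2 hcos) (cosh_pos (q * (2 * (n / 2 + 2 : ℕ) - (n + 3)))).le
    linarith
  · intro k _
    have e1 := fourthDiff_cos p (n + 3) k
    have e2 := fourthDiff_cosh q (n + 3) k
    rw [hqs] at e2
    simp only [fourthDiff] at e1 e2 ⊢
    linear_combination cosh (q * (n + 1)) * e1 - cos (p * (n + 1)) * e2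

theorem tendsto_mul_div_of_hasDerivAt {f : ℝ → ℝ} {c : ℝ} (hf : HasDerivAt f c 0) (h0 : f 0 = 0)
    (t : ℝ) : Tendsto (fun n : ℕ => ((n : ℝ) + 2) * f (t / (n + 2))) atTop (𝓝 (c * t)) := by
  have hN : Tendsto (fun n : ℕ => (n : ℝ) + 2) atTop atTop :=
    tendsto_atTop_add_const_right _ _ tendsto_natCast_atTop_atTop
  have h1 : HasDerivAt (fun x => f (t * x)) (c * t) 0 := by
    have : HasDerivAt (fun x : ℝ => t * x) t 0 := by simpa using (hasDerivAt_id (0 : ℝ)).const_mul t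
    exact HasDerivAt.comp 0 (by simpa using hf) this
  have h2 := h1.tendsto_slope_zero_right
  have h3 : Tendsto (fun n : ℕ => ((n : ℝ) + 2)⁻¹) atTop (𝓝[>] 0) :=
    tendsto_inv_atTop_nhdsGT_zero.comp hN
  refine (h2.comp h3).congr fun n => ?_
  simp [h0, div_eq_mul_inv]

theorem tendsto_evenDet_factor (t : ℝ) :
    Tendsto (fun n : ℕ =>
      cos t * cos (t / (n + 2)) * sinh ((n + 2) * arsinh (sin (t / (n + 2)))) +
        sin t * (cosh ((n + 2) * arsinh (sin (t / (n + 2)))) *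
          cosh (arsinh (sin (t / (n + 2)))))) atTop (𝓝 (beam t)) := by
  have hN : Tendsto (fun n : ℕ => (n : ℝ) + 2) atTop atTop :=
    tendsto_atTop_add_const_right _ _ tendsto_natCast_atTop_atTop
  have h1 : Tendsto (fun n : ℕ => t / ((n : ℝ) + 2)) atTop (𝓝 0) := hN.const_div_atTop t
  have h2 : Tendsto (fun n : ℕ => ((n : ℝ) + 2) * arsinh (sin (t / (n + 2)))) atTop (𝓝 t) := by
    have hd : HasDerivAt (fun x => arsinh (sin x)) 1 0 := by
      have := (hasDerivAt_sin 0).arsinh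
      simpa using this
    simpa using tendsto_mul_div_of_hasDerivAt hd (by simp) t
  have h3 : Tendsto (fun n : ℕ => cos (t / ((n : ℝ) + 2))) atTop (𝓝 1) := by
    simpa [Function.comp_def] using (continuous_cos.tendsto 0).comp h1
  have h4 : Tendsto (fun n : ℕ => cosh (arsinh (sin (t / ((n : ℝ) + 2))))) atTop (𝓝 1) := by
    have h : Continuous fun x : ℝ => cosh (arsinh (sin x)) :=
      continuous_cosh.comp (continuous_arsinh.comp continuous_sin)
    have h' := (h.tendsto 0).comp h1
    rw [sin_zero, arsinh_zero, cosh_zero] at h'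
    exact h'
  have h5 := (continuous_sinh.tendsto t).comp h2
  have h6 := (continuous_cosh.tendsto t).comp h2
  have := ((h3.const_mul (cos t)).mul h5).add ((h6.mul h4).const_mul (sin t))
  simpa [beam, Function.comp_def] using this

theorem eventually_exists_mem_spectrum {t₀ t₁ : ℝ} (h₀ : t₀ ∈ Ioo (π / 2) π) (hb : beam t₀ = 0)
    (h₁ : t₁ ∈ Ioo t₀ π) :
    ∀ᶠ n : ℕ in atTop, ∃ μ ∈ spectrum ℝ (T n), ((n : ℝ) + 2) ^ 4 * μ ≤ (2 * t₁) ^ 4 := by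
  have hN : Tendsto (fun n : ℕ => (n : ℝ) + 2) atTop atTop :=
    tendsto_atTop_add_const_right _ _ tendsto_natCast_atTop_atTop
  have hneg : beam t₁ < 0 := by
    rw [← hb]
    exact strictAntiOn_beam ⟨h₀.1.le, h₀.2.le⟩ ⟨(h₀.1.trans h₁.1).le, h₁.2.le⟩ h₁.1
  have hlim : Tendsto (fun n : ℕ => t₀ / ((n : ℝ) + 2)) atTop (𝓝 0) := hN.const_div_atTop t₀
  filter_upwards [(tendsto_evenDet_factor t₁).eventually_lt_const hneg, eventually_ge_atTop 1,
    hlim.eventually_lt_const (sub_pos.2 h₀.1)] with n hfac hn hlarge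
  have hn' : (1 : ℝ) ≤ n := by exact_mod_cast hn
  have ht₀ : 0 < t₀ := by linarith [h₀.1, pi_pos]
  have hbound : ∀ t, 0 < t → t ≤ t₁ → t / (n + 2) ∈ Ioo 0 (π / 2) := by
    intro t ht ht'
    refine ⟨by positivity, ?_⟩
    rw [div_lt_iff₀ (by positivity)]
    nlinarith [h₁.2, pi_pos]
  have hs : 0 < sin (t₁ / (n + 2)) := by
    have := hbound t₁ (ht₀.trans h₁.1) le_rfl
    exact sin_pos_of_pos_of_lt_pi this.1 (by linarith [this.2, pi_pos])
  have hd₁ : evenDet n t₁ < 0 := by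
    rw [evenDet_eq]
    exact mul_neg_of_pos_of_neg (by positivity) hfac
  have hcont : ContinuousOn (evenDet n) (Icc t₀ t₁) := by
    unfold evenDet
    fun_prop
  obtain ⟨t, ht, e⟩ := intermediate_value_Icc' h₁.1.le hcont
    ⟨hd₁.le, (evenDet_pos hn ht₀ le_rfl h₀ hb).le⟩
  have ht0 : 0 < t := ht₀.trans_le ht.1
  have hp := hbound t ht0 ht.2
  refine ⟨_, mem_spectrum_of_evenDet_eq_zero hn e hp ?_, ?_⟩
  · have e1 : t / ((n : ℝ) + 2) * (n + 1) = t - t / (n + 2) := by field_simp; ring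
    have e2 : t₀ - t₀ / ((n : ℝ) + 2) ≤ t - t / (n + 2) := by
      have : t₀ / ((n : ℝ) + 2) * (n + 1) ≤ t / (n + 2) * (n + 1) := by
        gcongr
        exact ht.1
      have e3 : t₀ / ((n : ℝ) + 2) * (n + 1) = t₀ - t₀ / (n + 2) := by field_simp; ring
      linarith
    rw [e1]
    exact cos_nonpos_of_pi_div_two_le_of_le (by linarith)
      (by linarith [hp.1, ht.2, h₁.2, pi_pos])
  · rw [← mul_pow]
    have hsn : 0 ≤ sin (t / (n + 2)) :=
      sin_nonneg_of_nonneg_of_le_pi hp.1.le (by linarith [hp.2, pi_pos])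
    have := mul_le_mul_of_nonneg_left (sin_le hp.1.le) (by positivity : (0 : ℝ) ≤ n + 2)
    rw [mul_div_cancel₀ _ (by positivity)] at this
    exact pow_le_pow_left₀ (by positivity) (by linarith [ht.2]) 4

/-- The smallest eigenvalue of `T n` is asymptotically `(2 * t₀ / (n + 2)) ^ 4`. -/
theorem tendsto_min_eigenvalue {t₀ : ℝ} (h₀ : t₀ ∈ Ioo (π / 2) π) (hb : beam t₀ = 0)
    {m : ℕ → ℝ} (hm : ∀ n, 1 ≤ n → m n ∈ spectrum ℝ (T n))
    (hmin : ∀ n, 1 ≤ n → ∀ μ ∈ spectrum ℝ (T n), m n ≤ μ) :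
    Tendsto (fun n : ℕ => ((n : ℝ) + 2) ^ 4 * m n) atTop (𝓝 ((2 * t₀) ^ 4)) := by
  refine tendsto_order.2 ⟨fun a ha => ?_, fun a ha => ?_⟩
  · have h1 : Tendsto (fun n : ℕ => (2 * (((n : ℝ) + 2) * sin (t₀ / (n + 2)))) ^ 4) atTop
        (𝓝 ((2 * t₀) ^ 4)) := by
      have := tendsto_mul_div_of_hasDerivAt (hasDerivAt_sin 0) sin_zero t₀
      rw [cos_zero, one_mul] at this
      exact (this.const_mul 2).pow 4
    filter_upwards [h1.eventually_const_lt ha, eventually_ge_atTop 1] with n h hn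
    refine h.trans ?_
    rw [show 2 * (((n : ℝ) + 2) * sin (t₀ / (n + 2))) = (n + 2) * (2 * sin (t₀ / (n + 2))) by ring,
      mul_pow]
    exact mul_lt_mul_of_pos_left (lt_of_mem_spectrum hn h₀ hb (hm n hn)) (by positivity)
  · have hcont : Tendsto (fun t : ℝ => (2 * t) ^ 4) (𝓝[>] t₀) (𝓝 ((2 * t₀) ^ 4)) :=
      (by fun_prop : Continuous fun t : ℝ => (2 * t) ^ 4).continuousWithinAt
    obtain ⟨t₁, ht₁, h₁⟩ := ((hcont.eventually_lt_const ha).and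
      (Ioo_mem_nhdsGT h₀.2)).exists
    filter_upwards [eventually_exists_mem_spectrum h₀ hb h₁, eventually_ge_atTop 1]
      with n ⟨μ, hμ, hle⟩ hn
    refine lt_of_le_of_lt ?_ (hle.trans_lt ht₁)
    exact mul_le_mul_of_nonneg_left (hmin n hn μ hμ) (by positivity)

theorem tendsto_max_eigenvalue {M : ℕ → ℝ} (hM : ∀ n, 1 ≤ n → M n ∈ spectrum ℝ (T n))
    (hmax : ∀ n, 1 ≤ n → ∀ μ ∈ spectrum ℝ (T n), μ ≤ M n) :
    Tendsto M atTop (𝓝 16) := by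
  have hlow : Tendsto (fun n : ℕ => 16 - 32 / (n : ℝ)) atTop (𝓝 16) := by
    simpa using (tendsto_const_div_atTop_nhds_zero_nat (32 : ℝ)).const_sub 16
  refine tendsto_of_tendsto_of_tendsto_of_le_of_le' hlow tendsto_const_nhds ?_ ?_
  · filter_upwards [eventually_ge_atTop 1] with n hn
    have h := opNorm2_T_lower n
    rw [opNorm2_T_eq (hM n hn) (hmax n hn)] at h
    have hn' : (0 : ℝ) < n := by exact_mod_cast hn
    refine le_of_mul_le_mul_right ?_ hn'
    rw [sub_mul, div_mul_cancel₀ _ hn'.ne']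
    linarith
  · filter_upwards [eventually_ge_atTop 1] with n hn
    exact spectrum_T_le (hM n hn)

theorem beam_eq_zero_of_tanh_eq {t : ℝ} (ht : t ∈ Ioo (π / 2) π) (h : tanh t = -tan t) :
    beam t = 0 := by
  have hcos : cos t ≠ 0 := (cos_neg_of_pi_div_two_lt_of_lt ht.1 (by linarith [ht.2, pi_pos])).ne
  have hcosh := (cosh_pos t).ne'
  rw [tanh_eq_sinh_div_cosh, tan_eq_sin_div_cos] at h
  field_simp at h
  rw [beam]
  linarith

theorem stmt17 (lam : ℕ → ℕ → ℝ)
    (hmono : ∀ n, 1 ≤ n → ∀ j k, 1 ≤ j → j < k → k ≤ n → lam n j < lam n k)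
    (hspec : ∀ n, 1 ≤ n → ∀ j, 1 ≤ j → j ≤ n → lam n j ∈ spectrum ℝ (T n))
    (alpha : ℕ → ℝ)
    (halpha : ∀ i : ℕ, 1 ≤ i →
      alpha i ∈ Set.Ioo ((i : ℝ) * Real.pi) (((i : ℝ) + 1) * Real.pi) ∧
      Real.tanh (alpha i / 2) = (-1 : ℝ) ^ i * Real.tan (alpha i / 2)) :
    (∀ n : ℕ, 1 ≤ n → IsUnit (T n)) ∧
    Filter.Tendsto (fun n : ℕ => (alpha 1 / ((n : ℝ) + 2)) ^ 4 * opNorm2 (T n)⁻¹)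
      Filter.atTop (nhds 1) ∧
    Filter.Tendsto
      (fun n : ℕ => (alpha 1 / ((n : ℝ) + 2)) ^ 4 * (opNorm2 (T n) * opNorm2 (T n)⁻¹))
      Filter.atTop (nhds 16) ∧
    Filter.Tendsto (fun n : ℕ => ((n : ℝ) + 2) ^ 4 * lam n 1) Filter.atTop
      (nhds ((alpha 1) ^ 4)) ∧
    Filter.Tendsto (fun n : ℕ => lam n n) Filter.atTop (nhds 16) := by
  have ⟨hα, htan⟩ := halpha 1 le_rfl
  norm_num at hα htan
  have h₀ : alpha 1 / 2 ∈ Ioo (π / 2) π := ⟨by linarith [hα.1], by linarith [hα.2]⟩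
  have hb := beam_eq_zero_of_tanh_eq h₀ htan
  have hall : ∀ n, 1 ≤ n → ∀ μ ∈ spectrum ℝ (T n), lam n 1 ≤ μ ∧ μ ≤ lam n n := by
    intro n hn μ hμ
    obtain ⟨j, hj1, hjn, rfl⟩ :=
      exists_eq_of_mem_spectrum (T_isHermitian n) (hmono n hn) (hspec n hn) hμ
    constructor
    · rcases hj1.eq_or_lt with rfl | h
      · exact le_rfl
      · exact (hmono n hn 1 j le_rfl h hjn).le
    · rcases hjn.eq_or_lt with rfl | h
      · exact le_rfl
      · exact (hmono n hn j n hj1 h le_rfl).le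
  have hm : ∀ n, 1 ≤ n → lam n 1 ∈ spectrum ℝ (T n) := fun n hn => hspec n hn 1 le_rfl hn
  have hM : ∀ n, 1 ≤ n → lam n n ∈ spectrum ℝ (T n) := fun n hn => hspec n hn n hn le_rfl
  have hmin := tendsto_min_eigenvalue h₀ hb hm fun n hn μ hμ => (hall n hn μ hμ).1
  have hmax := tendsto_max_eigenvalue hM fun n hn μ hμ => (hall n hn μ hμ).2
  rw [mul_div_cancel₀ _ two_ne_zero] at hmin
  have hα4 : alpha 1 ^ 4 ≠ 0 := pow_ne_zero 4 (by linarith [hα.1, pi_pos])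
  have hinv : Tendsto (fun n : ℕ => (alpha 1 / ((n : ℝ) + 2)) ^ 4 * opNorm2 (T n)⁻¹)
      atTop (𝓝 1) := by
    have h := (hmin.inv₀ hα4).const_mul (alpha 1 ^ 4)
    rw [mul_inv_cancel₀ hα4] at h
    refine h.congr' ?_
    filter_upwards [eventually_ge_atTop 1] with n hn
    rw [opNorm2_T_inv_eq (hm n hn) fun μ hμ => (hall n hn μ hμ).1, mul_inv, div_pow]
    ring
  refine ⟨fun n _ => isUnit_T n, hinv, ?_, hmin, hmax⟩
  have h := hmax.mul hinv
  rw [mul_one] at h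
  refine h.congr' ?_
  filter_upwards [eventually_ge_atTop 1] with n hn
  rw [opNorm2_T_eq (hM n hn) fun μ hμ => (hall n hn μ hμ).2]
  ring
end

section
/- lim_{n→∞} (n+2)·(λ_{n,2}^{1/4} − λ_{n,1}^{1/4}) = α_2 − α_1, and moreover α_2 − α_1 < π. -/
open Real Set Filter Topology

theorem sum_T_mul (n : ℕ) (y : ℤ → ℝ) (h₁ : y (-1) = 0) (h₀ : y 0 = 0)
    (h₂ : y (n + 1) = 0) (h₃ : y (n + 2) = 0) (j : Fin n) :
    ∑ k : Fin n, T n j k * y ((k : ℤ) + 1) =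
      y ((j : ℤ) + 3) - 4 * y ((j : ℤ) + 2) + 6 * y ((j : ℤ) + 1) - 4 * y (j : ℤ)
        + y ((j : ℤ) - 1) := by
  let t : ℤ → ℝ := fun d => if d = 0 then 6 else if d = 1 ∨ d = -1 then -4
    else if d = 2 ∨ d = -2 then 1 else 0
  have ht : ∀ i : ℕ, t ((j : ℤ) + 2 - i) =
      (if (j : ℕ) + 2 = i then 6 else 0) + (if (j : ℕ) + 1 = i then -4 else 0)
      + (if (j : ℕ) + 3 = i then -4 else 0) + (if (j : ℕ) = i then 1 else 0)
      + (if (j : ℕ) + 4 = i then 1 else 0) := by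
    intro i
    simp only [t]
    split_ifs <;> first | omega | norm_num
  have hext : ∑ k : Fin n, T n j k * y ((k : ℤ) + 1) =
      ∑ i ∈ Finset.range (n + 4), t ((j : ℤ) + 2 - i) * y ((i : ℤ) - 1) := by
    rw [Finset.sum_range_succ, Finset.sum_range_succ, Finset.sum_range_succ',
      Finset.sum_range_succ', ← Fin.sum_univ_eq_sum_range
        (fun i => t ((j : ℤ) + 2 - ((i + 1 + 1 : ℕ) : ℤ)) * y (((i + 1 + 1 : ℕ) : ℤ) - 1))]
    have e₂ : (((n + 2 : ℕ) : ℤ) - 1) = n + 1 := by push_cast; ring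
    have e₃ : (((n + 3 : ℕ) : ℤ) - 1) = n + 2 := by push_cast; ring
    rw [e₂, e₃, h₂, h₃]
    simp only [Nat.cast_zero, zero_add, Nat.cast_one, sub_self, zero_sub, h₁, h₀, mul_zero,
      add_zero]
    refine Finset.sum_congr rfl fun k _ => ?_
    have e : (j : ℤ) + 2 - ((k + 1 + 1 : ℕ) : ℤ) = j - k := by push_cast; ring
    have e' : (((k + 1 + 1 : ℕ) : ℤ) - 1) = k + 1 := by push_cast; ring
    rw [e, e']
    simp [T, t]
  rw [hext]
  simp only [ht, add_mul, ite_mul, zero_mul, Finset.sum_add_distrib, Finset.sum_ite_eq,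
    Finset.mem_range]
  have hj := j.2
  rw [if_pos (by omega), if_pos (by omega), if_pos (by omega), if_pos (by omega),
    if_pos (by omega)]
  have e₁ : (((j + 2 : ℕ) : ℤ) - 1) = j + 1 := by push_cast; ring
  have e₂ : (((j + 1 : ℕ) : ℤ) - 1) = j := by push_cast; ring
  have e₃ : (((j + 3 : ℕ) : ℤ) - 1) = j + 2 := by push_cast; ring
  have e₄ : (((j + 4 : ℕ) : ℤ) - 1) = j + 3 := by push_cast; ring
  rw [e₁, e₂, e₃, e₄]
  ring

theorem mem_spectrum_T_of_boundary {n : ℕ} (hn : 2 ≤ n) {φ δ p : ℝ} (hφ : Real.sin φ ≠ 0)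
    (hp : p ≠ 0) {h : ℤ → ℝ}
    (hrec : ∀ k, h (k + 1) + h (k - 1) = (4 - 2 * Real.cos φ) * h k) (hμ : Real.cos φ ≠ 1)
    (h₁ : p * Real.cos (φ * (-1 : ℤ) + δ) + h (-1) = 0)
    (h₀ : p * Real.cos (φ * (0 : ℤ) + δ) + h 0 = 0)
    (h₂ : p * Real.cos (φ * ((n + 1 : ℤ) : ℝ) + δ) + h (n + 1) = 0)
    (h₃ : p * Real.cos (φ * ((n + 2 : ℤ) : ℝ) + δ) + h (n + 2) = 0) :
    (2 - 2 * Real.cos φ) ^ 2 ∈ spectrum ℝ (T n) := by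
  set c : ℤ → ℝ := fun k => p * Real.cos (φ * k + δ) with hc
  have crec : ∀ k, c (k + 1) + c (k - 1) = 2 * Real.cos φ * c k := by
    intro k
    have e₁ : φ * ((k + 1 : ℤ) : ℝ) + δ = (φ * k + δ) + φ := by push_cast; ring
    have e₂ : φ * ((k - 1 : ℤ) : ℝ) + δ = (φ * k + δ) - φ := by push_cast; ring
    simp only [hc, e₁, e₂, Real.cos_add (_ + _), Real.cos_sub]
    ring
  have key : ∀ k : ℤ, (c (k + 2) + h (k + 2)) - 4 * (c (k + 1) + h (k + 1))
      + 6 * (c k + h k) - 4 * (c (k - 1) + h (k - 1)) + (c (k - 2) + h (k - 2)) =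
      (2 - 2 * Real.cos φ) ^ 2 * (c k + h k) := by
    intro k
    have a₁ := crec (k + 1)
    have a₂ := crec k
    have a₃ := crec (k - 1)
    have b₁ := hrec (k + 1)
    have b₂ := hrec k
    have b₃ := hrec (k - 1)
    rw [show k + 1 + 1 = k + 2 by ring, show k + 1 - 1 = k by ring] at a₁ b₁
    rw [show k - 1 + 1 = k by ring, show k - 1 - 1 = k - 2 by ring] at a₃ b₃
    linear_combination a₁ + a₃ + (2 * Real.cos φ - 4) * a₂ + b₁ + b₃ - 2 * Real.cos φ * b₂
  rw [← Matrix.spectrum_toLin', ← Module.End.hasEigenvalue_iff_mem_spectrum]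
  refine Module.End.hasEigenvalue_of_hasEigenvector
    (x := fun k : Fin n => c ((k : ℤ) + 1) + h ((k : ℤ) + 1)) ?_
  rw [Module.End.hasEigenvector_iff, Module.End.mem_eigenspace_iff]
  constructor
  · ext j
    rw [Matrix.toLin'_apply, Matrix.mulVec, dotProduct,
      sum_T_mul n (fun k => c k + h k) h₁ h₀ h₂ h₃ j]
    have := key (j + 1)
    rw [show (j : ℤ) + 1 + 2 = j + 3 by ring, show (j : ℤ) + 1 + 1 = j + 2 by ring,
      show (j : ℤ) + 1 - 1 = j by ring, show (j : ℤ) + 1 - 2 = j - 1 by ring] at this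
    simpa using this
  · intro hzero
    have hx : ∀ k : ℕ, k ≤ n + 1 → c k + h k = 0 := by
      intro k hk
      rcases Nat.eq_zero_or_pos k with rfl | hpos
      · simpa [hc] using h₀
      rcases Nat.lt_or_ge n k with hlt | hle
      · obtain rfl : k = n + 1 := by omega
        simpa [hc] using h₂
      · have := congrFun hzero ⟨k - 1, by omega⟩
        simpa [Nat.cast_sub (show 1 ≤ k from hpos)] using this
    have hcz : ∀ k : ℕ, k + 1 ≤ n → c (k + 1) = 0 := by
      intro k hk
      have z₀ := hx k (by omega)
      have z₁ := hx (k + 1) (by omega)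
      have z₂ := hx (k + 2) (by omega)
      push_cast at z₁ z₂
      have a := crec (k + 1)
      have b := hrec (k + 1)
      rw [show (k : ℤ) + 1 + 1 = k + 2 by ring, show (k : ℤ) + 1 - 1 = k by ring] at a b
      have : (Real.cos φ - 1) * c (k + 1) = 0 := by
        linear_combination (-1 / 4) * (a + b) + (1 / 4) * (z₀ + z₂)
          - (1 / 4) * (4 - 2 * Real.cos φ) * z₁
      exact (mul_eq_zero.mp this).resolve_left (sub_ne_zero.mpr hμ)
    have c₁ := hcz 0 (by omega)
    have c₂ := hcz 1 (by omega)
    have d₁ := (mul_eq_zero.mp c₁).resolve_left hp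
    have d₂ := (mul_eq_zero.mp c₂).resolve_left hp
    push_cast at d₁ d₂
    norm_num only [mul_one] at d₁ d₂
    rw [show φ * 2 + δ = (φ + δ) + φ by ring, Real.cos_add (φ + δ), d₁] at d₂
    have hs : Real.sin (φ + δ) = 0 := by
      have : Real.sin (φ + δ) * Real.sin φ = 0 := by linarith
      exact (mul_eq_zero.mp this).resolve_right hφ
    have := Real.sin_sq_add_cos_sq (φ + δ)
    rw [hs, d₁] at this
    norm_num at this

/-- Vanishing of this function at `x` yields an eigenvector of `T n`, `m = n + 2`, that is
symmetric under reversal of the index set, with eigenvalue `g (2 * x)`. -/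
noncomputable def symmDet (m x : ℝ) : ℝ :=
  Real.cos (m * x) * Real.cos x * Real.sinh (m * Real.arsinh (Real.sin x)) +
    Real.sin (m * x) * Real.cosh (Real.arsinh (Real.sin x)) *
      Real.cosh (m * Real.arsinh (Real.sin x))

/-- Vanishing of this function at `x` yields an eigenvector of `T n`, `m = n + 2`, that is
antisymmetric under reversal of the index set, with eigenvalue `g (2 * x)`. -/
noncomputable def antisymmDet (m x : ℝ) : ℝ :=
  Real.sin (m * x) * Real.cos x * Real.cosh (m * Real.arsinh (Real.sin x)) -
    Real.cos (m * x) * Real.cosh (Real.arsinh (Real.sin x)) *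
      Real.sinh (m * Real.arsinh (Real.sin x))

theorem two_sub_two_mul_cos (x : ℝ) : (2 - 2 * Real.cos (2 * x)) ^ 2 = g (2 * x) := by
  rw [g, Real.cos_two_mul, Real.cos_sq']
  rw [show 2 * x / 2 = x by ring]
  ring

theorem cosh_two_mul_arsinh_sin (x : ℝ) :
    2 * Real.cosh (2 * Real.arsinh (Real.sin x)) = 4 - 2 * Real.cos (2 * x) := by
  rw [Real.cosh_two_mul, Real.cosh_sq, Real.sinh_arsinh, Real.cos_two_mul, Real.cos_sq']
  ring

theorem sin_two_mul_ne_zero {x : ℝ} (hx : x ∈ Set.Ioo 0 (π / 2)) : Real.sin (2 * x) ≠ 0 :=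
  (Real.sin_pos_of_pos_of_lt_pi (by linarith [hx.1]) (by linarith [hx.2])).ne'

theorem cos_two_mul_ne_one {x : ℝ} (hx : x ∈ Set.Ioo 0 (π / 2)) : Real.cos (2 * x) ≠ 1 := by
  intro h
  have := Real.sin_sq_add_cos_sq (2 * x)
  rw [h] at this
  exact sin_two_mul_ne_zero hx (by nlinarith)

theorem g_mem_spectrum_of_symmDet {n : ℕ} (hn : 2 ≤ n) {x : ℝ} (hx : x ∈ Set.Ioo 0 (π / 2))
    (h : symmDet (n + 2) x = 0) : g (2 * x) ∈ spectrum ℝ (T n) := by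
  rw [symmDet] at h
  rw [← two_sub_two_mul_cos]
  have hb := cosh_two_mul_arsinh_sin x
  have hs := Real.sinh_arsinh (Real.sin x)
  set y := Real.arsinh (Real.sin x)
  set X := ((n : ℝ) + 2) * x with hX
  set Y := ((n : ℝ) + 2) * y with hY
  have hend : Real.cosh (Y - y) * Real.cos (X + x) - Real.cos (X - x) * Real.cosh (Y + y) = 0 := by
    rw [Real.cosh_sub, Real.cosh_add, Real.cos_add, Real.cos_sub, hs]
    linear_combination (-2 * Real.sin x) * h
  refine mem_spectrum_T_of_boundary hn (φ := 2 * x) (δ := -(X - x)) (p := Real.cosh (Y - y))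
    (h := fun k => -Real.cos (X - x) * Real.cosh (2 * y * k - (Y - y)))
    (sin_two_mul_ne_zero hx) (Real.cosh_pos _).ne' (fun k => ?_) (cos_two_mul_ne_one hx) ?_ ?_ ?_ ?_
  · rw [← hb]
    have e₁ : 2 * y * ((k + 1 : ℤ) : ℝ) - (Y - y) = (2 * y * k - (Y - y)) + 2 * y := by
      push_cast; ring
    have e₂ : 2 * y * ((k - 1 : ℤ) : ℝ) - (Y - y) = (2 * y * k - (Y - y)) - 2 * y := by
      push_cast; ring
    simp only [e₁, e₂, Real.cosh_add (_ - _), Real.cosh_sub (_ - _) (2 * y)]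
    ring
  · rw [← hend, ← Real.cos_neg (X + x), ← Real.cosh_neg (Y + y)]
    push_cast; ring_nf
  · rw [← Real.cos_neg (X - x), ← Real.cosh_neg (Y - y)]
    push_cast; ring_nf
  · have e₁ : 2 * x * ((n + 1 : ℤ) : ℝ) + -(X - x) = X - x := by push_cast; rw [hX]; ring
    have e₂ : 2 * y * ((n + 1 : ℤ) : ℝ) - (Y - y) = Y - y := by push_cast; rw [hY]; ring
    simp only [e₁, e₂]
    ring
  · have e₁ : 2 * x * ((n + 2 : ℤ) : ℝ) + -(X - x) = X + x := by push_cast; rw [hX]; ring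
    have e₂ : 2 * y * ((n + 2 : ℤ) : ℝ) - (Y - y) = Y + y := by push_cast; rw [hY]; ring
    simp only [e₁, e₂]
    linear_combination hend

theorem g_mem_spectrum_of_antisymmDet {n : ℕ} (hn : 2 ≤ n) {x : ℝ} (hx : x ∈ Set.Ioo 0 (π / 2))
    (h : antisymmDet (n + 2) x = 0) : g (2 * x) ∈ spectrum ℝ (T n) := by
  rw [antisymmDet] at h
  rw [← two_sub_two_mul_cos]
  have hb := cosh_two_mul_arsinh_sin x
  have hs := Real.sinh_arsinh (Real.sin x)
  have hypos : 0 < Real.arsinh (Real.sin x) :=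
    Real.arsinh_pos_iff.mpr (Real.sin_pos_of_pos_of_lt_pi hx.1 (by linarith [hx.2, hx.1]))
  set y := Real.arsinh (Real.sin x)
  set X := ((n : ℝ) + 2) * x with hX
  set Y := ((n : ℝ) + 2) * y with hY
  have hYy : 0 < Y - y := by
    rw [hY, show ((n : ℝ) + 2) * y - y = (n + 1) * y by ring]
    positivity
  have hend : Real.sinh (Y - y) * Real.sin (X + x) - Real.sin (X - x) * Real.sinh (Y + y) = 0 := by
    rw [Real.sinh_sub, Real.sinh_add, Real.sin_add, Real.sin_sub, hs]
    linear_combination (-2 * Real.sin x) * h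
  refine mem_spectrum_T_of_boundary hn (φ := 2 * x) (δ := -(X - x) - π / 2)
    (p := Real.sinh (Y - y))
    (h := fun k => -Real.sin (X - x) * Real.sinh (2 * y * k - (Y - y)))
    (sin_two_mul_ne_zero hx) (Real.sinh_pos_iff.mpr hYy).ne' (fun k => ?_)
    (cos_two_mul_ne_one hx) ?_ ?_ ?_ ?_
  · rw [← hb]
    have e₁ : 2 * y * ((k + 1 : ℤ) : ℝ) - (Y - y) = (2 * y * k - (Y - y)) + 2 * y := by
      push_cast; ring
    have e₂ : 2 * y * ((k - 1 : ℤ) : ℝ) - (Y - y) = (2 * y * k - (Y - y)) - 2 * y := by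
      push_cast; ring
    simp only [e₁, e₂, Real.sinh_add (_ - _), Real.sinh_sub (_ - _) (2 * y)]
    ring
  · have e₁ : 2 * x * ((-1 : ℤ) : ℝ) + (-(X - x) - π / 2) = -(X + x) - π / 2 := by push_cast; ring
    have e₂ : 2 * y * ((-1 : ℤ) : ℝ) - (Y - y) = -(Y + y) := by push_cast; ring
    simp only [e₁, e₂, Real.cos_sub_pi_div_two, Real.sin_neg, Real.sinh_neg]
    linear_combination -hend
  · have e₁ : 2 * x * ((0 : ℤ) : ℝ) + (-(X - x) - π / 2) = -(X - x) - π / 2 := by push_cast; ring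
    have e₂ : 2 * y * ((0 : ℤ) : ℝ) - (Y - y) = -(Y - y) := by push_cast; ring
    simp only [e₁, e₂, Real.cos_sub_pi_div_two, Real.sin_neg, Real.sinh_neg]
    ring
  · have e₁ : 2 * x * ((n + 1 : ℤ) : ℝ) + (-(X - x) - π / 2) = X - x - π / 2 := by
      push_cast; rw [hX]; ring
    have e₂ : 2 * y * ((n + 1 : ℤ) : ℝ) - (Y - y) = Y - y := by push_cast; rw [hY]; ring
    simp only [e₁, e₂, Real.cos_sub_pi_div_two]
    ring
  · have e₁ : 2 * x * ((n + 2 : ℤ) : ℝ) + (-(X - x) - π / 2) = X + x - π / 2 := by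
      push_cast; rw [hX]; ring
    have e₂ : 2 * y * ((n + 2 : ℤ) : ℝ) - (Y - y) = Y + y := by push_cast; rw [hY]; ring
    simp only [e₁, e₂, Real.cos_sub_pi_div_two]
    linear_combination hend

theorem exists_mem_Ioo_eq_zero {f : ℝ → ℝ} {a b : ℝ} (hab : a ≤ b) (hf : ContinuousOn f (Icc a b))
    (h : f a * f b < 0) : ∃ x ∈ Ioo a b, f x = 0 := by
  rcases mul_neg_iff.mp h with ⟨ha, hb⟩ | ⟨ha, hb⟩
  · exact intermediate_value_Ioo' hab hf ⟨hb, ha⟩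
  · exact intermediate_value_Ioo hab hf ⟨ha, hb⟩

theorem continuous_arsinh_sin : Continuous fun x => Real.arsinh (Real.sin x) :=
  Real.continuous_arsinh.comp Real.continuous_sin

theorem continuous_symmDet (m : ℝ) : Continuous (symmDet m) := by
  unfold symmDet
  have := continuous_arsinh_sin
  fun_prop

theorem continuous_antisymmDet (m : ℝ) : Continuous (antisymmDet m) := by
  unfold antisymmDet
  have := continuous_arsinh_sin
  fun_prop

theorem arsinh_sin_pos_s18 {x : ℝ} (hx : x ∈ Ioo 0 (π / 2)) : 0 < Real.arsinh (Real.sin x) :=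
  Real.arsinh_pos_iff.mpr (Real.sin_pos_of_pos_of_lt_pi hx.1 (by linarith [hx.2, hx.1]))

/-- The function among `symmDet` and `antisymmDet` that belongs to the `j`-th eigenvalue. -/
noncomputable def parityDet (j : ℕ) : ℝ → ℝ → ℝ :=
  if Even j then antisymmDet else symmDet

theorem exists_parityDet_eq_zero {n j : ℕ} (hj : 1 ≤ j) (hjn : j ≤ n) :
    ∃ x ∈ Ioo (j * (π / 2) / ((n : ℝ) + 2)) ((j + 1) * (π / 2) / ((n : ℝ) + 2)),
      parityDet j (n + 2) x = 0 := by
  have hm : (0 : ℝ) < (n : ℝ) + 2 := by positivity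
  have hjn' : (j : ℝ) ≤ n := by exact_mod_cast hjn
  have hj' : (1 : ℝ) ≤ j := by exact_mod_cast hj
  set a := j * (π / 2) / ((n : ℝ) + 2) with ha
  set b := (j + 1) * (π / 2) / ((n : ℝ) + 2) with hb
  have hma : ((n : ℝ) + 2) * a = j * (π / 2) := by rw [ha]; field_simp
  have hmb : ((n : ℝ) + 2) * b = (j + 1) * (π / 2) := by rw [hb]; field_simp
  have hpi := Real.pi_pos
  have hab : a ≤ b := by
    rw [ha, hb]
    gcongr
    linarith
  have ha0 : 0 < a := by rw [ha]; positivity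
  have hb1 : b < π / 2 := by
    rw [hb, div_lt_iff₀ hm]
    nlinarith
  have haI : a ∈ Ioo 0 (π / 2) := ⟨ha0, by linarith⟩
  have hbI : b ∈ Ioo 0 (π / 2) := ⟨by linarith, hb1⟩
  have hca : 0 < Real.cos a := Real.cos_pos_of_mem_Ioo ⟨by linarith [haI.1], haI.2⟩
  have hcb : 0 < Real.cos b := Real.cos_pos_of_mem_Ioo ⟨by linarith [hbI.1], hbI.2⟩
  have hsa : 0 < Real.sinh (((n : ℝ) + 2) * Real.arsinh (Real.sin a)) :=
    Real.sinh_pos_iff.mpr (mul_pos hm (arsinh_sin_pos_s18 haI))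
  have hsb : 0 < Real.sinh (((n : ℝ) + 2) * Real.arsinh (Real.sin b)) :=
    Real.sinh_pos_iff.mpr (mul_pos hm (arsinh_sin_pos_s18 hbI))
  have hsign : ∀ i : ℕ, ((-1 : ℝ) ^ i) * ((-1 : ℝ) ^ i) = 1 := fun i => by
    rw [← mul_pow]; norm_num
  unfold parityDet
  split_ifs with he
  · obtain ⟨i, rfl⟩ := he
    refine exists_mem_Ioo_eq_zero hab (continuous_antisymmDet _).continuousOn ?_
    have e₁ : ((i + i : ℕ) : ℝ) * (π / 2) = i * π := by push_cast; ring
    have e₂ : (((i + i : ℕ) : ℝ) + 1) * (π / 2) = i * π + π / 2 := by push_cast; ring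
    simp only [antisymmDet, hma, hmb, e₁, e₂, Real.sin_nat_mul_pi, Real.cos_nat_mul_pi,
      Real.sin_add_pi_div_two, Real.cos_add_pi_div_two]
    have hP := mul_pos (mul_pos (Real.cosh_pos (Real.arsinh (Real.sin a))) hsa)
      (mul_pos hcb (Real.cosh_pos (((n : ℝ) + 2) * Real.arsinh (Real.sin b))))
    linear_combination hP - (hsign i) * (Real.cosh (Real.arsinh (Real.sin a)) *
      Real.sinh (((n : ℝ) + 2) * Real.arsinh (Real.sin a)) *
      (Real.cos b * Real.cosh (((n : ℝ) + 2) * Real.arsinh (Real.sin b))))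
  · obtain ⟨i, rfl⟩ := Nat.not_even_iff_odd.mp he
    refine exists_mem_Ioo_eq_zero hab (continuous_symmDet _).continuousOn ?_
    have e₁ : ((2 * i + 1 : ℕ) : ℝ) * (π / 2) = i * π + π / 2 := by push_cast; ring
    have e₂ : (((2 * i + 1 : ℕ) : ℝ) + 1) * (π / 2) = i * π + π := by push_cast; ring
    simp only [symmDet, hma, hmb, e₁, e₂, Real.sin_nat_mul_pi, Real.cos_nat_mul_pi,
      Real.sin_add_pi_div_two, Real.cos_add_pi_div_two, Real.sin_add_pi, Real.cos_add_pi]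
    have hP := mul_pos (mul_pos (Real.cosh_pos (Real.arsinh (Real.sin a)))
      (Real.cosh_pos (((n : ℝ) + 2) * Real.arsinh (Real.sin a)))) (mul_pos hcb hsb)
    linear_combination hP - (hsign i) * (Real.cosh (Real.arsinh (Real.sin a)) *
      Real.cosh (((n : ℝ) + 2) * Real.arsinh (Real.sin a)) *
      (Real.cos b * Real.sinh (((n : ℝ) + 2) * Real.arsinh (Real.sin b))))

theorem eq_of_strictMono_of_mem_spectrum {n : ℕ} (A : Matrix (Fin n) (Fin n) ℝ) {f₁ f₂ : Fin n → ℝ}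
    (h₁ : StrictMono f₁) (h₂ : StrictMono f₂) (hs₁ : ∀ i, f₁ i ∈ spectrum ℝ A)
    (hs₂ : ∀ i, f₂ i ∈ spectrum ℝ A) : f₁ = f₂ := by
  set S := A.charpoly.roots.toFinset with hS
  have hmem : ∀ r ∈ spectrum ℝ A, r ∈ S := fun r hr => by
    rw [hS, Multiset.mem_toFinset, Polynomial.mem_roots A.charpoly_monic.ne_zero]
    exact Matrix.mem_spectrum_iff_isRoot_charpoly.mp hr
  have hle : S.card ≤ n := by
    calc S.card ≤ A.charpoly.roots.card := Multiset.toFinset_card_le _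
      _ ≤ A.charpoly.natDegree := Polynomial.card_roots' _
      _ = n := by rw [Matrix.charpoly_natDegree_eq_dim, Fintype.card_fin]
  have hge : n ≤ S.card := by
    have := Finset.card_le_card_of_injOn (s := Finset.univ) (t := S) f₁
      (fun i _ => hmem _ (hs₁ i)) h₁.injective.injOn
    simpa using this
  have hcard : S.card = n := le_antisymm hle hge
  rw [Finset.orderEmbOfFin_unique hcard (fun i => hmem _ (hs₁ i)) h₁,
    Finset.orderEmbOfFin_unique hcard (fun i => hmem _ (hs₂ i)) h₂]

theorem g_lt_g {x y : ℝ} (hx : 0 < x) (hxy : x < y) (hy : y < π / 2) : g (2 * x) < g (2 * y) := by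
  simp only [g, mul_div_cancel_left₀ _ (two_ne_zero' ℝ)]
  have h₀ := Real.sin_pos_of_pos_of_lt_pi hx (by linarith)
  have := Real.sin_lt_sin_of_lt_of_le_pi_div_two (by linarith) hy.le hxy
  gcongr

theorem eq_g_of_root {n : ℕ} (hn : 2 ≤ n) {l : ℕ → ℝ}
    (hl : ∀ j k, 1 ≤ j → j < k → k ≤ n → l j < l k)
    (hspec : ∀ j, 1 ≤ j → j ≤ n → l j ∈ spectrum ℝ (T n)) {x : ℕ → ℝ}
    (hx : ∀ j, 1 ≤ j → j ≤ n →
      x j ∈ Ioo (j * (π / 2) / ((n : ℝ) + 2)) ((j + 1) * (π / 2) / ((n : ℝ) + 2)) ∧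
        parityDet j (n + 2) (x j) = 0) {j : ℕ} (hj : 1 ≤ j) (hjn : j ≤ n) :
    l j = g (2 * x j) := by
  have hpi := Real.pi_pos
  have hmem : ∀ j, 1 ≤ j → j ≤ n → x j ∈ Ioo 0 (π / 2) := by
    intro j hj hjn
    obtain ⟨⟨h₁, h₂⟩, -⟩ := hx j hj hjn
    refine ⟨lt_trans (by positivity) h₁, h₂.trans ?_⟩
    have : (j : ℝ) ≤ n := by exact_mod_cast hjn
    rw [div_lt_iff₀ (by positivity)]
    nlinarith
  have hlt : ∀ j k, 1 ≤ j → j < k → k ≤ n → x j < x k := by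
    intro j k hj hjk hk
    refine (hx j hj (by omega)).1.2.trans_le (le_trans ?_ (hx k (by omega) hk).1.1.le)
    have : (j : ℝ) + 1 ≤ k := by exact_mod_cast hjk
    gcongr
  have := eq_of_strictMono_of_mem_spectrum (T n) (f₁ := fun i : Fin n => l (i + 1))
    (f₂ := fun i : Fin n => g (2 * x (i + 1)))
    (fun i k hik => hl _ _ (by omega) (by simpa using hik) k.2)
    (fun i k hik => g_lt_g (hmem _ (by omega) i.2).1
      (hlt _ _ (by omega) (by simpa using hik) k.2) (hmem _ (by omega) k.2).2)
    (fun i => hspec _ (by omega) i.2)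
    (fun i => by
      have h := (hx (i + 1) (by omega) i.2).2
      have hI := hmem (i + 1) (by omega) i.2
      unfold parityDet at h
      split_ifs at h
      · exact g_mem_spectrum_of_antisymmDet hn hI h
      · exact g_mem_spectrum_of_symmDet hn hI h)
  have := congrFun this ⟨j - 1, by omega⟩
  simpa [Nat.sub_add_cancel hj] using this

theorem tendsto_mul_comp_of_hasDerivAt {ι : Type*} {l : Filter ι} {f : ℝ → ℝ}
    (hf : HasDerivAt f 1 0) (hf0 : f 0 = 0) {m w : ι → ℝ} {t : ℝ} (hw : Tendsto w l (𝓝 0))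
    (hmw : Tendsto (fun i => m i * w i) l (𝓝 t)) :
    Tendsto (fun i => m i * f (w i)) l (𝓝 t) := by
  have hs : Tendsto (fun i => dslope f 0 (w i)) l (𝓝 1) := by
    have := (continuousAt_dslope_same.mpr hf.differentiableAt).tendsto.comp hw
    rwa [dslope_same, hf.deriv] at this
  have := hmw.mul hs
  rw [mul_one] at this
  refine this.congr fun i => ?_
  have h := sub_smul_dslope f 0 (w i)
  rw [sub_zero, hf0, sub_zero, smul_eq_mul] at h
  rw [mul_assoc, h]

theorem hasDerivAt_arsinh_sin_zero : HasDerivAt (fun x => Real.arsinh (Real.sin x)) 1 0 := by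
  have := (Real.hasDerivAt_arsinh (Real.sin 0)).comp 0 (Real.hasDerivAt_sin 0)
  simpa [Function.comp_def] using this

theorem tendsto_symmDet {ι : Type*} {l : Filter ι} {m w : ι → ℝ} {t : ℝ} (hw : Tendsto w l (𝓝 0))
    (hmw : Tendsto (fun i => m i * w i) l (𝓝 t)) :
    Tendsto (fun i => symmDet (m i) (w i)) l
      (𝓝 (Real.cos t * Real.sinh t + Real.sin t * Real.cosh t)) := by
  have hy := tendsto_mul_comp_of_hasDerivAt hasDerivAt_arsinh_sin_zero (by simp) hw hmw
  have hc := (Real.continuous_cos.tendsto 0).comp hw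
  have hA := ((Real.continuous_cosh.comp continuous_arsinh_sin).tendsto 0).comp hw
  have h := (((((Real.continuous_cos.tendsto t).comp hmw).mul hc).mul
    ((Real.continuous_sinh.tendsto t).comp hy)).add
    ((((Real.continuous_sin.tendsto t).comp hmw).mul hA).mul
      ((Real.continuous_cosh.tendsto t).comp hy)))
  simpa [symmDet, Function.comp_def] using h

theorem tendsto_antisymmDet {ι : Type*} {l : Filter ι} {m w : ι → ℝ} {t : ℝ}
    (hw : Tendsto w l (𝓝 0)) (hmw : Tendsto (fun i => m i * w i) l (𝓝 t)) :
    Tendsto (fun i => antisymmDet (m i) (w i)) l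
      (𝓝 (Real.sin t * Real.cosh t - Real.cos t * Real.sinh t)) := by
  have hy := tendsto_mul_comp_of_hasDerivAt hasDerivAt_arsinh_sin_zero (by simp) hw hmw
  have hc := (Real.continuous_cos.tendsto 0).comp hw
  have hA := ((Real.continuous_cosh.comp continuous_arsinh_sin).tendsto 0).comp hw
  have h := (((((Real.continuous_sin.tendsto t).comp hmw).mul hc).mul
    ((Real.continuous_cosh.tendsto t).comp hy)).sub
    ((((Real.continuous_cos.tendsto t).comp hmw).mul hA).mul
      ((Real.continuous_sinh.tendsto t).comp hy)))
  simpa [antisymmDet, Function.comp_def] using h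

theorem tendsto_rpow_g {D : ℝ → ℝ → ℝ} {L : ℝ → ℝ} {a b t₀ : ℝ}
    (hD : ∀ (l : Filter ℕ) (w : ℕ → ℝ) (t : ℝ), Tendsto w l (𝓝 0) →
      Tendsto (fun n : ℕ => ((n : ℝ) + 2) * w n) l (𝓝 t) →
      Tendsto (fun n : ℕ => D (n + 2) (w n)) l (𝓝 (L t)))
    (huniq : ∀ t ∈ Icc a b, L t = 0 → t = t₀) (ha : 0 ≤ a) {w : ℕ → ℝ}
    (hw : ∀ᶠ n : ℕ in atTop, ((n : ℝ) + 2) * w n ∈ Icc a b ∧ D (n + 2) (w n) = 0) :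
    Tendsto (fun n : ℕ => ((n : ℝ) + 2) * g (2 * w n) ^ ((1 : ℝ) / 4)) atTop (𝓝 (2 * t₀)) := by
  have hinv : Tendsto (fun n : ℕ => ((n : ℝ) + 2)⁻¹) atTop (𝓝 0) :=
    tendsto_inv_atTop_zero.comp
      (tendsto_atTop_add_const_right _ _ tendsto_natCast_atTop_atTop)
  have hzero : ∀ (l : Filter ℕ) (t : ℝ), l ≤ atTop →
      Tendsto (fun n : ℕ => ((n : ℝ) + 2) * w n) l (𝓝 t) → Tendsto w l (𝓝 0) := by
    intro l t hl ht
    have := ht.mul (hinv.mono_left hl)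
    rw [mul_zero] at this
    refine this.congr fun n => ?_
    field_simp
  have hlim : Tendsto (fun n : ℕ => ((n : ℝ) + 2) * w n) atTop (𝓝 t₀) := by
    rw [tendsto_iff_ultrafilter]
    intro U hU
    have hUw : ∀ᶠ n : ℕ in U, ((n : ℝ) + 2) * w n ∈ Icc a b ∧ D (n + 2) (w n) = 0 := hU hw
    obtain ⟨t, htI, ht⟩ := isCompact_iff_ultrafilter_le_nhds.mp (isCompact_Icc (a := a) (b := b))
      (U.map fun n : ℕ => ((n : ℝ) + 2) * w n)
      (le_principal_iff.mpr (hUw.mono fun n h => h.1))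
    have hconv := hD U w t (hzero U t hU ht) ht
    have hL : L t = 0 := tendsto_nhds_unique_of_eventuallyEq hconv tendsto_const_nhds
      (hUw.mono fun n h => h.2)
    rw [← huniq t htI hL]
    exact ht
  have hw0 := hzero atTop t₀ le_rfl hlim
  have hsin := (tendsto_mul_comp_of_hasDerivAt (by simpa using Real.hasDerivAt_sin 0)
    Real.sin_zero hw0 hlim).const_mul 2
  refine hsin.congr' ?_
  filter_upwards [hw, hw0.eventually (Iio_mem_nhds Real.pi_pos)] with n hn hpi
  have hwn : 0 ≤ w n := by
    have := ha.trans hn.1.1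
    exact nonneg_of_mul_nonneg_right this (by positivity)
  have hs : 0 ≤ 2 * Real.sin (w n) :=
    mul_nonneg zero_le_two (Real.sin_nonneg_of_nonneg_of_le_pi hwn (le_of_lt hpi))
  have := Real.pow_rpow_inv_natCast hs (n := 4) (by norm_num)
  rw [g, mul_div_cancel_left₀ _ (two_ne_zero' ℝ), one_div]
  push_cast at this
  rw [this]
  ring

theorem strictAntiOn_cos_sinh_add_sin_cosh :
    StrictAntiOn (fun t => Real.cos t * Real.sinh t + Real.sin t * Real.cosh t)
      (Icc (π / 2) π) := by
  refine strictAntiOn_of_deriv_neg (convex_Icc _ _) (by fun_prop) fun t ht => ?_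
  rw [interior_Icc] at ht
  have hd := ((Real.hasDerivAt_cos t).mul (Real.hasDerivAt_sinh t)).add
    ((Real.hasDerivAt_sin t).mul (Real.hasDerivAt_cosh t))
  have hcos := Real.cos_neg_of_pi_div_two_lt_of_lt ht.1 (by linarith [ht.2, Real.pi_pos])
  have heq : deriv (fun t => Real.cos t * Real.sinh t + Real.sin t * Real.cosh t) t =
      2 * (Real.cos t * Real.cosh t) := hd.deriv.trans (by ring)
  rw [heq]
  exact mul_neg_of_pos_of_neg two_pos (mul_neg_of_neg_of_pos hcos (Real.cosh_pos t))

theorem strictAntiOn_sin_cosh_sub_cos_sinh :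
    StrictAntiOn (fun t => Real.sin t * Real.cosh t - Real.cos t * Real.sinh t)
      (Icc π (3 * (π / 2))) := by
  refine strictAntiOn_of_deriv_neg (convex_Icc _ _) (by fun_prop) fun t ht => ?_
  rw [interior_Icc] at ht
  have hpi := Real.pi_pos
  have hd := ((Real.hasDerivAt_sin t).mul (Real.hasDerivAt_cosh t)).sub
    ((Real.hasDerivAt_cos t).mul (Real.hasDerivAt_sinh t))
  have hsin : Real.sin t < 0 := by
    have := Real.sin_pos_of_pos_of_lt_pi (x := t - π) (by linarith [ht.1]) (by linarith [ht.2])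
    rw [Real.sin_sub_pi] at this
    linarith
  have heq : deriv (fun t => Real.sin t * Real.cosh t - Real.cos t * Real.sinh t) t =
      2 * (Real.sin t * Real.sinh t) := hd.deriv.trans (by ring)
  rw [heq]
  exact mul_neg_of_pos_of_neg two_pos
    (mul_neg_of_neg_of_pos hsin (Real.sinh_pos_iff.mpr (by linarith [ht.1])))

theorem three_mul_pi_div_four_lt {t : ℝ} (ht : t ∈ Icc (π / 2) π)
    (h : Real.cos t * Real.sinh t + Real.sin t * Real.cosh t = 0) : 3 * π / 4 < t := by
  have hpi := Real.pi_pos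
  refine (strictAntiOn_cos_sinh_add_sin_cosh.lt_iff_gt ht
    (b := 3 * π / 4) ⟨by linarith, by linarith⟩).mp ?_
  simp only [h]
  rw [show 3 * π / 4 = π - π / 4 by ring, Real.cos_pi_sub, Real.sin_pi_sub, Real.cos_pi_div_four,
    Real.sin_pi_div_four]
  have := mul_pos (show (0 : ℝ) < √2 / 2 by positivity)
    (sub_pos.mpr (Real.sinh_lt_cosh (π - π / 4)))
  linarith

theorem lt_five_mul_pi_div_four {t : ℝ} (ht : t ∈ Icc π (3 * (π / 2)))
    (h : Real.sin t * Real.cosh t - Real.cos t * Real.sinh t = 0) : t < 5 * π / 4 := by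
  have hpi := Real.pi_pos
  refine (strictAntiOn_sin_cosh_sub_cos_sinh.lt_iff_gt
    (a := 5 * π / 4) ⟨by linarith, by linarith⟩ ht).mp ?_
  simp only [h]
  rw [show 5 * π / 4 = π / 4 + π by ring, Real.cos_add_pi, Real.sin_add_pi, Real.cos_pi_div_four,
    Real.sin_pi_div_four]
  have := mul_pos (show (0 : ℝ) < √2 / 2 by positivity)
    (sub_pos.mpr (Real.sinh_lt_cosh (π / 4 + π)))
  linarith

theorem sinh_mul_cos_of_tanh_eq {c t : ℝ} (ht : Real.cos t ≠ 0)
    (h : Real.tanh t = c * Real.tan t) :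
    Real.sinh t * Real.cos t = c * (Real.sin t * Real.cosh t) := by
  have := (Real.cosh_pos t).ne'
  rw [Real.tanh_eq_sinh_div_cosh, Real.tan_eq_sin_div_cos] at h
  field_simp at h
  linarith

theorem stmt18 (lam : ℕ → ℕ → ℝ)
    (hmono : ∀ n, 1 ≤ n → ∀ j k, 1 ≤ j → j < k → k ≤ n → lam n j < lam n k)
    (hspec : ∀ n, 1 ≤ n → ∀ j, 1 ≤ j → j ≤ n → lam n j ∈ spectrum ℝ (T n))
    (alpha : ℕ → ℝ)
    (halpha : ∀ i : ℕ, 1 ≤ i →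
      alpha i ∈ Set.Ioo ((i : ℝ) * Real.pi) (((i : ℝ) + 1) * Real.pi) ∧
      Real.tanh (alpha i / 2) = (-1 : ℝ) ^ i * Real.tan (alpha i / 2)) :
    Filter.Tendsto
      (fun n : ℕ => ((n : ℝ) + 2) *
        ((lam n 2) ^ ((1 : ℝ) / 4) - (lam n 1) ^ ((1 : ℝ) / 4)))
      Filter.atTop (nhds (alpha 2 - alpha 1)) ∧
    alpha 2 - alpha 1 < Real.pi := by
  have hpi := Real.pi_pos
  obtain ⟨⟨l₁, u₁⟩, ht₁⟩ := halpha 1 le_rfl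
  obtain ⟨⟨l₂, u₂⟩, ht₂⟩ := halpha 2 one_le_two
  push_cast at l₁ u₁ l₂ u₂
  have hα₁ : Real.cos (alpha 1 / 2) * Real.sinh (alpha 1 / 2) +
      Real.sin (alpha 1 / 2) * Real.cosh (alpha 1 / 2) = 0 := by
    have := sinh_mul_cos_of_tanh_eq
      (Real.cos_neg_of_pi_div_two_lt_of_lt (by linarith) (by linarith)).ne ht₁
    linarith
  have hα₂ : Real.sin (alpha 2 / 2) * Real.cosh (alpha 2 / 2) -
      Real.cos (alpha 2 / 2) * Real.sinh (alpha 2 / 2) = 0 := by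
    have := sinh_mul_cos_of_tanh_eq
      (Real.cos_neg_of_pi_div_two_lt_of_lt (by linarith) (by linarith)).ne ht₂
    linarith
  have hI₁ : alpha 1 / 2 ∈ Icc (π / 2) π := ⟨by linarith, by linarith⟩
  have hI₂ : alpha 2 / 2 ∈ Icc π (3 * (π / 2)) := ⟨by linarith, by linarith⟩
  refine ⟨?_, by linarith [three_mul_pi_div_four_lt hI₁ hα₁, lt_five_mul_pi_div_four hI₂ hα₂]⟩
  have hroots : ∀ n j : ℕ, ∃ x : ℝ, 1 ≤ j → j ≤ n →
      x ∈ Ioo (j * (π / 2) / ((n : ℝ) + 2)) ((j + 1) * (π / 2) / ((n : ℝ) + 2)) ∧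
        parityDet j (n + 2) x = 0 := by
    intro n j
    by_cases h : 1 ≤ j ∧ j ≤ n
    · obtain ⟨x, hx⟩ := exists_parityDet_eq_zero h.1 h.2
      exact ⟨x, fun _ _ => hx⟩
    · exact ⟨0, fun h₁ h₂ => absurd ⟨h₁, h₂⟩ h⟩
  choose x hx using hroots
  have hlam : ∀ j, 1 ≤ j → ∀ᶠ n in atTop, lam n j = g (2 * x n j) := by
    intro j hj
    filter_upwards [eventually_ge_atTop (max 2 j)] with n hn
    exact eq_g_of_root (le_of_max_le_left hn) (hmono n (by omega)) (hspec n (by omega))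
      (hx n) hj (le_of_max_le_right hn)
  have hloc : ∀ j : ℕ, 1 ≤ j → ∀ᶠ n : ℕ in atTop,
      ((n : ℝ) + 2) * x n j ∈ Icc (j * (π / 2)) ((j + 1) * (π / 2)) ∧
        parityDet j (n + 2) (x n j) = 0 := by
    intro j hj
    filter_upwards [eventually_ge_atTop j] with n hn
    obtain ⟨⟨h₁, h₂⟩, h₃⟩ := hx n j hj hn
    rw [div_lt_iff₀' (by positivity)] at h₁
    rw [lt_div_iff₀' (by positivity)] at h₂
    exact ⟨⟨h₁.le, h₂.le⟩, h₃⟩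
  have hlim₁ := tendsto_rpow_g (t₀ := alpha 1 / 2)
    (fun _ _ _ hw hmw => by simpa [parityDet] using tendsto_symmDet hw hmw)
    (fun t ht h0 => strictAntiOn_cos_sinh_add_sin_cosh.injOn
      (by convert ht using 2 <;> push_cast <;> ring) hI₁ (h0.trans hα₁.symm))
    (by positivity) (hloc 1 le_rfl)
  have hlim₂ := tendsto_rpow_g (t₀ := alpha 2 / 2)
    (fun _ _ _ hw hmw => by simpa [parityDet] using tendsto_antisymmDet hw hmw)
    (fun t ht h0 => strictAntiOn_sin_cosh_sub_cos_sinh.injOn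
      (by convert ht using 2 <;> push_cast <;> ring) hI₂ (h0.trans hα₂.symm))
    (by positivity) (hloc 2 one_le_two)
  have h := hlim₂.sub hlim₁
  rw [mul_div_cancel₀ _ (two_ne_zero' ℝ), mul_div_cancel₀ _ (two_ne_zero' ℝ)] at h
  refine h.congr' ?_
  filter_upwards [hlam 1 le_rfl, hlam 2 one_le_two] with n h₁ h₂
  rw [h₁, h₂]
  ring
end
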